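/- For every nonnegative integer n, the number of diagonal-lattice walks of length 2n that start at (0,0), end at (−4,0), and are confined to the three-quadrant cone C equals (16^n / 3^5) · ( −3^5 · n · ((1/2)_n)² / ( (2)_n (2)_{n+1} ) + 4·(21n² + 30n − 14) · (1/2)_n (7/6)_n / ( (2)_{n+1} (4/3)_{n+1} ) − 7·(3n² + 3n − 10) · (1/2)_n (5/6)_n / ( (2)_{n+1} (5/3)_{n+1} ) ). -/

import Mathlib

/-- Square-lattice steps. -/
def squareSteps : Set (ℤ × ℤ) := {(1,0), (-1,0), (0,1), (0,-1)}

/-- Diagonal-lattice steps. -/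
def diagSteps : Set (ℤ × ℤ) := {(1,1), (1,-1), (-1,1), (-1,-1)}

/-- The three-quadrant cone `C = {(i,j) : i ≥ 0 or j ≥ 0}`. -/
def coneC : Set (ℤ × ℤ) := {p | 0 ≤ p.1 ∨ 0 ≤ p.2}

/-- The quadrant `Q = {(i,j) : i ≥ 0 and j ≥ 0}`. -/
def quadQ : Set (ℤ × ℤ) := {p | 0 ≤ p.1 ∧ 0 ≤ p.2}

/-- Number of walks of length `n` with steps in `steps`, from `a` to `b`,
confined to `region`. -/
noncomputable def walkCount (steps region : Set (ℤ × ℤ)) (a b : ℤ × ℤ) (n : ℕ) : ℕ :=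
  Nat.card {w : Fin (n+1) → ℤ × ℤ //
    w 0 = a ∧ w (Fin.last n) = b ∧
    (∀ k : Fin n, w k.succ - w k.castSucc ∈ steps) ∧
    (∀ k, w k ∈ region)}

/-- Ascending factorial (Pochhammer symbol) `(a)ₙ = a(a+1)⋯(a+n-1)`. -/
noncomputable def poch (a : ℚ) (n : ℕ) : ℚ := (ascPochhammer ℚ n).eval a

section PowerSeriesTools

open PowerSeries

variable {R B : Type*} [CommRing R] [CommRing B]

/-- The series of coefficients of `f` shifted down by one. -/
noncomputable def tailSeries (f : R⟦X⟧) : R⟦X⟧ :=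
  PowerSeries.mk fun n => coeff (n + 1) f

theorem eq_C_add_X_mul_tailSeries (f : R⟦X⟧) :
    f = C (coeff 0 f) + X * tailSeries f := by
  ext n
  cases n with
  | zero => simp
  | succ n => simp [coeff_succ_X_mul, tailSeries]

theorem eq_zero_of_forall_X_pow_dvd {f : R⟦X⟧} (h : ∀ n : ℕ, X ^ n ∣ f) : f = 0 := by
  ext n
  simpa using X_pow_dvd_iff.1 (h (n + 1)) n (Nat.lt_succ_self n)

/-- A series with coefficients in `R`, evaluated coefficientwise through `φ : R → B⟦X⟧`. -/
noncomputable def seriesLiftFun (φ : R →+* B⟦X⟧) (f : R⟦X⟧) : B⟦X⟧ :=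
  PowerSeries.mk fun m => ∑ p ∈ Finset.HasAntidiagonal.antidiagonal m, coeff p.2 (φ (coeff p.1 f))

theorem seriesLiftFun_eq (φ : R →+* B⟦X⟧) (f : R⟦X⟧) :
    seriesLiftFun φ f = φ (coeff 0 f) + X * seriesLiftFun φ (tailSeries f) := by
  ext n
  cases n with
  | zero => simp [seriesLiftFun]
  | succ n =>
    rw [map_add, coeff_succ_X_mul, seriesLiftFun, seriesLiftFun, coeff_mk, coeff_mk,
      Finset.Nat.sum_antidiagonal_succ]
    simp [tailSeries]

theorem seriesLiftFun_add (φ : R →+* B⟦X⟧) (f g : R⟦X⟧) :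
    seriesLiftFun φ (f + g) = seriesLiftFun φ f + seriesLiftFun φ g := by
  ext n
  simp [seriesLiftFun, Finset.sum_add_distrib]

theorem seriesLiftFun_X_mul (φ : R →+* B⟦X⟧) (f : R⟦X⟧) :
    seriesLiftFun φ (X * f) = X * seriesLiftFun φ f := by
  rw [seriesLiftFun_eq]
  have : tailSeries (X * f) = f := by
    ext n; simp [tailSeries, coeff_succ_X_mul]
  simp [this]

theorem seriesLiftFun_C (φ : R →+* B⟦X⟧) (a : R) : seriesLiftFun φ (C a) = φ a := by
  rw [seriesLiftFun_eq]
  have : tailSeries (C a : R⟦X⟧) = 0 := by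
    ext n; simp [tailSeries]
  have h0 : seriesLiftFun φ (0 : R⟦X⟧) = 0 := by ext n; simp [seriesLiftFun]
  simp [this, h0]

theorem seriesLiftFun_C_mul (φ : R →+* B⟦X⟧) (a : R) (g : R⟦X⟧) :
    seriesLiftFun φ (C a * g) = φ a * seriesLiftFun φ g := by
  ext m
  induction m generalizing g with
  | zero => rw [seriesLiftFun_eq φ (C a * g), seriesLiftFun_eq φ g]; simp
  | succ m ih =>
    have h : C a * g = C (a * coeff 0 g) + X * (C a * tailSeries g) := by
      conv_lhs => rw [eq_C_add_X_mul_tailSeries g]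
      rw [map_mul]; ring
    rw [h, seriesLiftFun_add, seriesLiftFun_X_mul, seriesLiftFun_C, map_mul, map_add, coeff_succ_X_mul, ih,
      seriesLiftFun_eq φ g, mul_add, map_add, mul_left_comm, coeff_succ_X_mul]

theorem seriesLiftFun_mul (φ : R →+* B⟦X⟧) (f g : R⟦X⟧) :
    seriesLiftFun φ (f * g) = seriesLiftFun φ f * seriesLiftFun φ g := by
  ext m
  induction m generalizing f with
  | zero => rw [seriesLiftFun_eq φ (f * g), seriesLiftFun_eq φ f, seriesLiftFun_eq φ g]; simp
  | succ m ih =>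
    have h : f * g = C (coeff 0 f) * g + X * (tailSeries f * g) := by
      conv_lhs => rw [eq_C_add_X_mul_tailSeries f]
      ring
    rw [h, seriesLiftFun_add, seriesLiftFun_X_mul, seriesLiftFun_C_mul, map_add, coeff_succ_X_mul, ih,
      seriesLiftFun_eq φ f, add_mul, map_add, mul_assoc, coeff_succ_X_mul]

/-- The ring homomorphism `∑ aₙ Xⁿ ↦ ∑ φ(aₙ) Xⁿ` induced by `φ : R → B⟦X⟧`. -/
noncomputable def seriesLift (φ : R →+* B⟦X⟧) : R⟦X⟧ →+* B⟦X⟧ where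
  toFun := seriesLiftFun φ
  map_one' := by simpa using seriesLiftFun_C φ 1
  map_mul' := seriesLiftFun_mul φ
  map_zero' := by simpa using seriesLiftFun_C φ 0
  map_add' := seriesLiftFun_add φ

theorem seriesLift_C (φ : R →+* B⟦X⟧) (a : R) : seriesLift φ (C a) = φ a := seriesLiftFun_C φ a

theorem seriesLift_X (φ : R →+* B⟦X⟧) : seriesLift φ X = X := by
  have := seriesLiftFun_X_mul φ (1 : R⟦X⟧)
  have h1 : seriesLiftFun φ 1 = 1 := (seriesLift φ).map_one
  rwa [mul_one, h1, mul_one] at this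

theorem coeff_zero_seriesLift (φ : R →+* B⟦X⟧) (f : R⟦X⟧) :
    coeff 0 (seriesLift φ f) = coeff 0 (φ (coeff 0 f)) := by
  change coeff 0 (seriesLiftFun φ f) = _
  rw [seriesLiftFun_eq]; simp

theorem seriesLift_map {A : Type*} [CommRing A] (φ : R →+* B⟦X⟧) (ι : A →+* R) (f : A⟦X⟧) :
    seriesLift φ (map ι f) = seriesLift (φ.comp ι) f := by
  ext m
  change coeff m (seriesLiftFun _ _) = coeff m (seriesLiftFun _ _)
  simp [seriesLiftFun]

theorem seriesLift_C_comp (ι : R →+* B) (f : R⟦X⟧) :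
    seriesLift ((C : B →+* B⟦X⟧).comp ι) f = map ι f := by
  ext m
  change coeff m (seriesLiftFun _ _) = _
  simp only [seriesLiftFun, coeff_mk, RingHom.comp_apply, coeff_C, coeff_map]
  rw [Finset.Nat.sum_antidiagonal_eq_sum_range_succ_mk, Finset.sum_range_succ]
  rw [Finset.sum_eq_zero]
  · simp
  · intro k hk
    have : m - k ≠ 0 := by have := Finset.mem_range.1 hk; omega
    simp [this]

/-- Hensel's lemma for power series over an arbitrary commutative ring. -/
theorem exists_root_of_simple_root (f : Polynomial R⟦X⟧) (a : R⟦X⟧)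
    (ha : X ∣ f.eval a) (hu : IsUnit (f.derivative.eval a)) :
    ∃ b, f.eval b = 0 ∧ X ∣ b - a := by
  obtain ⟨i, hi⟩ := hu.exists_left_inv
  let s : ℕ → R⟦X⟧ := fun k => Nat.rec a (fun _ u => u - i * f.eval u) k
  have hs : ∀ k, s (k + 1) = s k - i * f.eval (s k) := fun _ => rfl
  have key : ∀ k, X ∣ s k - a ∧ X ^ (k + 1) ∣ f.eval (s k) := by
    intro k
    induction k with
    | zero => exact ⟨by simp [s], by simpa [s] using ha⟩
    | succ k ih =>
      obtain ⟨⟨c, hc⟩, d, hd⟩ := ih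
      refine ⟨⟨c - i * X ^ k * d, ?_⟩, ?_⟩
      · rw [hs, hd]; linear_combination hc
      · obtain ⟨q, hq⟩ := f.binomExpansion (s k) (-(i * f.eval (s k)))
        obtain ⟨r, hr⟩ := (f.derivative).sub_dvd_eval_sub (s k) a
        rw [hs, sub_eq_add_neg, hq]
        refine ⟨-(c * r * i * d) + q * i ^ 2 * X ^ k * d ^ 2, ?_⟩
        have hr' : f.derivative.eval (s k) = f.derivative.eval a + X * c * r := by
          rw [← hc]; linear_combination hr
        rw [hr', hd]
        linear_combination (-(X ^ (k + 1) * d)) * hi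
  have hcong : ∀ n k, X ^ (n + 1) ∣ s (n + k) - s n := by
    intro n k
    induction k with
    | zero => simp
    | succ k ih =>
      have h1 : X ^ (n + 1) ∣ f.eval (s (n + k)) :=
        (pow_dvd_pow X (by omega)).trans (key (n + k)).2
      have h2 : s (n + (k + 1)) - s n = (s (n + k) - s n) - i * f.eval (s (n + k)) := by
        rw [← add_assoc, hs]; ring
      rw [h2]
      exact dvd_sub ih (h1.mul_left _)
  let b : R⟦X⟧ := PowerSeries.mk fun n => coeff n (s n)
  have hb : ∀ n, X ^ (n + 1) ∣ b - s n := by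
    intro n
    rw [X_pow_dvd_iff]
    intro m hm
    obtain ⟨k, rfl⟩ : ∃ k, n = m + k := ⟨n - m, by omega⟩
    have := X_pow_dvd_iff.1 (hcong m k) m (Nat.lt_succ_self m)
    rw [map_sub] at this ⊢
    simp only [b, coeff_mk]
    linear_combination -this
  refine ⟨b, eq_zero_of_forall_X_pow_dvd fun n => ?_, by simpa [s] using hb 0⟩
  have h1 := ((hb n).trans (f.sub_dvd_eval_sub b (s n)))
  have h2 := dvd_add h1 (key n).2
  rw [sub_add_cancel] at h2
  exact (pow_dvd_pow X (Nat.le_succ n)).trans h2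

end PowerSeriesTools

section WalkRecursion

/-- The walks enumerated by `walkCount`. -/
abbrev ConfinedWalk (steps region : Set (ℤ × ℤ)) (a b : ℤ × ℤ) (n : ℕ) : Type :=
  {w : Fin (n+1) → ℤ × ℤ //
    w 0 = a ∧ w (Fin.last n) = b ∧
    (∀ k : Fin n, w k.succ - w k.castSucc ∈ steps) ∧
    (∀ k, w k ∈ region)}

theorem confinedWalk_sigma_ext {steps region : Set (ℤ × ℤ)} {a b : ℤ × ℤ} {n : ℕ}
    (p q : Σ s : steps, ConfinedWalk steps region a (b - s) n) (h1 : p.1 = q.1)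
    (h2 : p.2.1 = q.2.1) : p = q := by
  obtain ⟨s, v⟩ := p
  obtain ⟨t, w⟩ := q
  obtain rfl : s = t := h1
  obtain rfl : v = w := Subtype.ext h2
  rfl

/-- Removing the last step of a walk. -/
def confinedWalkSuccEquiv (steps region : Set (ℤ × ℤ)) (a b : ℤ × ℤ) (hb : b ∈ region) (n : ℕ) :
    ConfinedWalk steps region a b (n + 1) ≃
      Σ s : steps, ConfinedWalk steps region a (b - s) n where
  toFun w := ⟨⟨w.1 (Fin.last (n + 1)) - w.1 (Fin.last n).castSucc, by
      have := w.2.2.2.1 (Fin.last n)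
      simpa using this⟩, ⟨fun k => w.1 k.castSucc, by
      obtain ⟨w, h0, h1, h2, h3⟩ := w
      refine ⟨h0, by simp [h1], fun k => ?_, fun k => h3 _⟩
      exact h2 k.castSucc⟩⟩
  invFun p := ⟨Fin.snoc p.2.1 b, by
      obtain ⟨⟨s, hs⟩, w, h0, h1, h2, h3⟩ := p
      refine ⟨?_, by simp, fun k => ?_, fun k => ?_⟩
      · exact (Fin.snoc_castSucc (α := fun _ => ℤ × ℤ) b w 0).trans h0
      · induction k using Fin.lastCases with
        | last => simp [h1, hs]
        | cast k =>
          rw [← Fin.castSucc_succ]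
          simpa only [Fin.snoc_castSucc] using h2 k
      · induction k using Fin.lastCases with
        | last => simpa using hb
        | cast k => simpa only [Fin.snoc_castSucc] using h3 k⟩
  left_inv w := by
    obtain ⟨w, h0, h1, h2, h3⟩ := w
    apply Subtype.ext
    funext k
    induction k using Fin.lastCases with
    | last => simp [h1]
    | cast k => simp
  right_inv p := by
    obtain ⟨⟨s, hs⟩, w, h0, h1, h2, h3⟩ := p
    refine confinedWalk_sigma_ext _ _ (Subtype.ext ?_) ?_
    · simp [h1]
    · funext k
      simp

theorem finite_confinedWalk (steps region : Set (ℤ × ℤ)) [Finite steps] (a b : ℤ × ℤ) (n : ℕ) :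
    Finite (ConfinedWalk steps region a b n) := by
  induction n generalizing b with
  | zero =>
    have : Subsingleton (ConfinedWalk steps region a b 0) := by
      refine ⟨fun v w => Subtype.ext (funext fun k => ?_)⟩
      rw [Fin.fin_one_eq_zero k, v.2.1, w.2.1]
    infer_instance
  | succ n ih =>
    by_cases hb : b ∈ region
    · have := fun s : steps => ih (b - s)
      exact Finite.of_equiv _ (confinedWalkSuccEquiv steps region a b hb n).symm
    · have : IsEmpty (ConfinedWalk steps region a b (n + 1)) :=
        ⟨fun w => hb (w.2.2.1 ▸ w.2.2.2.2 _)⟩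
      infer_instance

theorem walkCount_zero (steps region : Set (ℤ × ℤ)) (a b : ℤ × ℤ) [Decidable (a = b)]
    (ha : a ∈ region) : walkCount steps region a b 0 = if a = b then 1 else 0 := by
  change Nat.card (ConfinedWalk steps region a b 0) = _
  split_ifs with h
  · subst h
    rw [Nat.card_eq_one_iff_unique]
    refine ⟨⟨fun v w => Subtype.ext (funext fun k => ?_)⟩,
      ⟨⟨fun _ => a, rfl, rfl, fun k => k.elim0, fun _ => ha⟩⟩⟩
    rw [Fin.fin_one_eq_zero k, v.2.1, w.2.1]
  · rw [Nat.card_eq_zero]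
    exact Or.inl ⟨fun w => h (w.2.1.symm.trans w.2.2.1)⟩

theorem walkCount_of_notMem (steps region : Set (ℤ × ℤ)) (a b : ℤ × ℤ) (n : ℕ)
    (hb : b ∉ region) : walkCount steps region a b n = 0 := by
  change Nat.card (ConfinedWalk steps region a b n) = _
  rw [Nat.card_eq_zero]
  exact Or.inl ⟨fun w => hb (w.2.2.1 ▸ w.2.2.2.2 _)⟩

theorem walkCount_diagSteps_succ (region : Set (ℤ × ℤ)) (a : ℤ × ℤ) (i j : ℤ) (n : ℕ)
    (hb : (i, j) ∈ region) :
    walkCount diagSteps region a (i, j) (n + 1) =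
      walkCount diagSteps region a (i + 1, j + 1) n + walkCount diagSteps region a (i + 1, j - 1) n +
      walkCount diagSteps region a (i - 1, j + 1) n +
      walkCount diagSteps region a (i - 1, j - 1) n := by
  let S : Finset (ℤ × ℤ) := {(1,1), (1,-1), (-1,1), (-1,-1)}
  have hS : diagSteps = (S : Set (ℤ × ℤ)) := by simp [S, diagSteps]
  rw [hS]
  have hfin := fun b => finite_confinedWalk (S : Set (ℤ × ℤ)) region a b n
  change Nat.card (ConfinedWalk S region a (i, j) (n + 1)) = _
  rw [Nat.card_congr (confinedWalkSuccEquiv S region a (i, j) hb n), Nat.card_sigma]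
  change ∑ s : S, walkCount S region a ((i, j) - s) n = _
  rw [Finset.sum_coe_sort S fun s => walkCount S region a ((i, j) - s) n]
  simp only [S]
  rw [Finset.sum_insert (by decide), Finset.sum_insert (by decide), Finset.sum_insert (by decide),
    Finset.sum_singleton]
  simp only [Prod.mk_sub_mk, sub_neg_eq_add]
  ring

end WalkRecursion

section ReducedCounts

/-- The number of `n`-step walks on `ℤ` from `0` to `i` with steps `±1`. -/
def lineCount : ℕ → ℤ → ℚ
  | 0, i => if i = 0 then 1 else 0
  | n + 1, i => lineCount n (i - 1) + lineCount n (i + 1)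

theorem lineCount_eq_zero (n : ℕ) (i : ℤ) (h : i < -n ∨ n < i) : lineCount n i = 0 := by
  induction n generalizing i with
  | zero => simp only [lineCount]; rw [if_neg]; push_cast at h; omega
  | succ n ih =>
    push_cast at h
    rw [lineCount, ih _ (by omega), ih _ (by omega), add_zero]

theorem lineCount_eq_zero_of_parity (n : ℕ) (i : ℤ) (h : ¬ (2 ∣ i - n)) : lineCount n i = 0 := by
  induction n generalizing i with
  | zero => simp only [lineCount]; rw [if_neg]; rintro rfl; simp at h
  | succ n ih =>
    push_cast at h
    rw [lineCount, ih _ (by omega), ih _ (by omega), add_zero]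

theorem lineCount_neg (n : ℕ) (i : ℤ) : lineCount n (-i) = lineCount n i := by
  induction n generalizing i with
  | zero => simp [lineCount]
  | succ n ih =>
    rw [lineCount, lineCount, add_comm, ← ih (i - 1), ← ih (i + 1)]
    congr 2 <;> ring

theorem lineCount_eq_choose (n k : ℕ) : lineCount n (2 * k - n) = n.choose k := by
  induction n generalizing k with
  | zero => cases k <;> simp [lineCount]; omega
  | succ n ih =>
    rw [lineCount]
    have h2 : lineCount n (2 * k - (n + 1 : ℕ) + 1) = n.choose k := by
      rw [← ih]; congr 1; push_cast; ring
    rw [h2]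
    cases k with
    | zero =>
      rw [lineCount_eq_zero n _ (by push_cast; omega)]; simp
    | succ k =>
      have h1 : lineCount n (2 * (k + 1 : ℕ) - (n + 1 : ℕ) - 1) = n.choose k := by
        rw [← ih]; congr 1; push_cast; ring
      rw [h1, Nat.choose_succ_succ]; push_cast; ring

/-- The antisymmetric extension, about `-1`, of the number of `n`-step nonnegative walks
from `0` to `i` with steps `±1`. -/
def ballot (n : ℕ) (i : ℤ) : ℚ := lineCount n i - lineCount n (i + 2)

theorem ballot_succ (n : ℕ) (i : ℤ) : ballot (n + 1) i = ballot n (i - 1) + ballot n (i + 1) := by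
  simp only [ballot, lineCount]
  rw [show i + 2 - 1 = i - 1 + 2 by ring, show i + 2 + 1 = i + 1 + 2 by ring]
  ring

theorem ballot_zero (i : ℤ) : ballot 0 i = (if i = 0 then 1 else 0) - if i = -2 then 1 else 0 := by
  simp only [ballot, lineCount]
  congr 1
  exact if_congr (by omega) rfl rfl

theorem ballot_reflect (n : ℕ) (i : ℤ) : ballot n (-2 - i) = -ballot n i := by
  simp only [ballot]
  rw [show -2 - i + 2 = -i by ring, lineCount_neg, ← lineCount_neg n (-2 - i)]
  rw [show -(-2 - i) = i + 2 by ring]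
  ring

theorem ballot_neg_one (n : ℕ) : ballot n (-1) = 0 := by
  have := ballot_reflect n (-1)
  norm_num at this
  linarith

theorem ballot_eq_zero (n : ℕ) (i : ℤ) (h : i < -n - 2 ∨ n < i) : ballot n i = 0 := by
  rw [ballot, lineCount_eq_zero _ _ (by omega), lineCount_eq_zero _ _ (by omega), sub_zero]

theorem ballot_eq_zero_of_parity (n : ℕ) (i : ℤ) (h : ¬ (2 ∣ i - n)) : ballot n i = 0 := by
  rw [ballot, lineCount_eq_zero_of_parity _ _ h, lineCount_eq_zero_of_parity _ _ (by omega),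
    sub_zero]

/-- The number of `n`-step diagonal walks from the origin to `(i, j)` in the three-quadrant cone. -/
noncomputable def coneCount (n : ℕ) (i j : ℤ) : ℚ := walkCount diagSteps coneC (0, 0) (i, j) n

theorem coneCount_zero (i j : ℤ) : coneCount 0 i j = if i = 0 ∧ j = 0 then 1 else 0 := by
  rw [coneCount, walkCount_zero _ _ _ _ (by simp [coneC])]
  push_cast
  exact if_congr (by simp [eq_comm]) rfl rfl

theorem coneCount_succ (n : ℕ) (i j : ℤ) (h : 0 ≤ i ∨ 0 ≤ j) :
    coneCount (n + 1) i j = coneCount n (i + 1) (j + 1) + coneCount n (i + 1) (j - 1) +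
      coneCount n (i - 1) (j + 1) + coneCount n (i - 1) (j - 1) := by
  simp only [coneCount]
  rw [walkCount_diagSteps_succ _ _ _ _ _ h]
  push_cast
  ring

theorem coneCount_of_neg (n : ℕ) (i j : ℤ) (hi : i < 0) (hj : j < 0) : coneCount n i j = 0 := by
  rw [coneCount, walkCount_of_notMem, Nat.cast_zero]
  simp only [coneC, Set.mem_ofPred_eq]
  omega

theorem coneCount_comm (n : ℕ) (i j : ℤ) : coneCount n i j = coneCount n j i := by
  induction n generalizing i j with
  | zero => simp only [coneCount_zero, and_comm]
  | succ n ih =>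
    by_cases h : 0 ≤ i ∨ 0 ≤ j
    · rw [coneCount_succ n i j h, coneCount_succ n j i h.symm, ih (i + 1), ih (i + 1), ih (i - 1),
        ih (i - 1)]
      ring
    · rw [coneCount_of_neg _ _ _ (by omega) (by omega), coneCount_of_neg _ _ _ (by omega) (by omega)]

theorem coneCount_eq_zero (n : ℕ) (i j : ℤ) (h : i < -n ∨ n < i) : coneCount n i j = 0 := by
  induction n generalizing i j with
  | zero => rw [coneCount_zero, if_neg]; push_cast at h; omega
  | succ n ih =>
    push_cast at h
    by_cases hc : 0 ≤ i ∨ 0 ≤ j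
    · rw [coneCount_succ n i j hc, ih _ _ (by omega), ih _ _ (by omega), ih _ _ (by omega),
        ih _ _ (by omega)]
      ring
    · exact coneCount_of_neg _ _ _ (by omega) (by omega)

theorem coneCount_eq_zero_of_parity (n : ℕ) (i j : ℤ) (h : ¬ (2 ∣ i - j)) :
    coneCount n i j = 0 := by
  induction n generalizing i j with
  | zero => rw [coneCount_zero, if_neg]; omega
  | succ n ih =>
    by_cases hc : 0 ≤ i ∨ 0 ≤ j
    · rw [coneCount_succ n i j hc, ih _ _ (by omega), ih _ _ (by omega), ih _ _ (by omega),
        ih _ _ (by omega)]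
      ring
    · exact coneCount_of_neg _ _ _ (by omega) (by omega)

/-- The algebraic part of the cone counts: one third of the quadrant counts, reflected into the
other two quadrants, is subtracted. -/
noncomputable def reducedCount (n : ℕ) (i j : ℤ) : ℚ :=
  coneCount n i j - ballot n i * ballot n j / 3

theorem reducedCount_succ (n : ℕ) (i j : ℤ) (h : 0 ≤ i ∨ 0 ≤ j) :
    reducedCount (n + 1) i j = reducedCount n (i + 1) (j + 1) + reducedCount n (i + 1) (j - 1) +
      reducedCount n (i - 1) (j + 1) + reducedCount n (i - 1) (j - 1) := by
  simp only [reducedCount, coneCount_succ n i j h, ballot_succ]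
  ring

theorem reducedCount_comm (n : ℕ) (i j : ℤ) : reducedCount n i j = reducedCount n j i := by
  rw [reducedCount, reducedCount, coneCount_comm, mul_comm]

theorem reducedCount_neg_one (n : ℕ) (i : ℤ) (h : i < 0) : reducedCount n i (-1) = 0 := by
  rw [reducedCount, coneCount_of_neg _ _ _ h (by omega), ballot_neg_one]
  ring

theorem reducedCount_eq_zero (n : ℕ) (i j : ℤ) (h : i < -n - 2 ∨ n < i) :
    reducedCount n i j = 0 := by
  rw [reducedCount, coneCount_eq_zero _ _ _ (by omega), ballot_eq_zero _ _ h]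
  ring

theorem reducedCount_eq_zero_of_parity (n : ℕ) (i j : ℤ) (h : ¬ (2 ∣ i - j)) :
    reducedCount n i j = 0 := by
  rw [reducedCount, coneCount_eq_zero_of_parity _ _ _ h]
  by_cases hi : 2 ∣ i - n
  · rw [ballot_eq_zero_of_parity n j (by omega)]; ring
  · rw [ballot_eq_zero_of_parity n i hi]; ring

theorem reducedCount_zero (i j : ℤ) (hi : i < 0) (hj : 0 ≤ j) :
    reducedCount 0 i j = if i = -2 ∧ j = 0 then 1 / 3 else 0 := by
  rw [reducedCount, coneCount_zero, ballot_zero, ballot_zero, if_neg (by omega), if_neg (by omega),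
    if_neg (by omega : ¬ j = -2)]
  by_cases h1 : i = -2 <;> by_cases h2 : j = 0 <;> norm_num [h1, h2]

theorem reducedCount_reflect (n : ℕ) (i j : ℤ) (hi : -1 ≤ i) (hj : -1 ≤ j) :
    reducedCount n i j = reducedCount n (-2 - i) j + reducedCount n i (-2 - j) := by
  induction n generalizing i j with
  | zero =>
    simp only [reducedCount, ballot_reflect, coneCount_zero, ballot_zero]
    by_cases h1 : i = 0 <;> by_cases h2 : j = 0 <;> simp [h1, h2] <;> grind
  | succ n ih =>
    rcases eq_or_lt_of_le hi with rfl | hi'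
    · norm_num
      rw [reducedCount_comm, reducedCount_neg_one _ _ (by omega)]
    rcases eq_or_lt_of_le hj with rfl | hj'
    · norm_num
      rw [reducedCount_neg_one _ _ (by omega)]
    rw [reducedCount_succ _ _ _ (by omega), reducedCount_succ _ _ _ (by omega),
      reducedCount_succ _ _ _ (by omega), ih (i + 1) (j + 1) (by omega) (by omega),
      ih (i + 1) (j - 1) (by omega) (by omega), ih (i - 1) (j + 1) (by omega) (by omega),
      ih (i - 1) (j - 1) (by omega) (by omega)]
    rw [show -2 - (i + 1) = -2 - i - 1 by ring, show -2 - (i - 1) = -2 - i + 1 by ring,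
      show -2 - (j + 1) = -2 - j - 1 by ring, show -2 - (j - 1) = -2 - j + 1 by ring]
    ring

/-- The reduced counts on the left arm of the cone, extended symmetrically about the vertical
line through `-1`. -/
noncomputable def halfPlaneCount (n : ℕ) (i j : ℤ) : ℚ := reducedCount n (-1 - |i|) j

theorem halfPlaneCount_neg (n : ℕ) (i j : ℤ) : halfPlaneCount n (-i) j = halfPlaneCount n i j := by
  rw [halfPlaneCount, halfPlaneCount, abs_neg]

theorem halfPlaneCount_neg_one (n : ℕ) (i : ℤ) : halfPlaneCount n i (-1) = 0 :=
  reducedCount_neg_one _ _ (by have := abs_nonneg i; omega)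

theorem halfPlaneCount_eq_zero (n : ℕ) (i j : ℤ) (h : i < -n - 1 ∨ n + 1 < i ∨ n < j) :
    halfPlaneCount n i j = 0 := by
  rw [halfPlaneCount]
  by_cases h' : n < j
  · rw [reducedCount_comm, reducedCount_eq_zero _ _ _ (by omega)]
  · refine reducedCount_eq_zero _ _ _ (Or.inl ?_)
    rcases abs_cases i with h1 | h1 <;> omega

theorem halfPlaneCount_even (n : ℕ) (i : ℤ) (h : 2 ∣ i) : halfPlaneCount n i 0 = 0 := by
  refine reducedCount_eq_zero_of_parity _ _ _ ?_
  rcases abs_cases i with h1 | h1 <;> omega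

theorem halfPlaneCount_succ (n : ℕ) (i j : ℤ) (hj : 0 ≤ j) :
    halfPlaneCount (n + 1) i j =
      halfPlaneCount n (i + 1) (j + 1) + halfPlaneCount n (i + 1) (j - 1) +
      halfPlaneCount n (i - 1) (j + 1) + halfPlaneCount n (i - 1) (j - 1) +
      if i = 0 then halfPlaneCount n (j + 2) 0 + halfPlaneCount n j 0 else 0 := by
  rcases lt_trichotomy i 0 with hi | rfl | hi
  · rw [if_neg hi.ne]
    simp only [halfPlaneCount]
    rw [reducedCount_succ _ _ _ (Or.inr hj), abs_of_neg hi, abs_of_neg (by omega : i - 1 < 0),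
      abs_of_nonpos (by omega : i + 1 ≤ 0)]
    ring_nf
  · simp only [halfPlaneCount, if_true]
    rw [reducedCount_succ _ _ _ (Or.inr hj), abs_of_nonneg hj, abs_of_nonneg (by omega : 0 ≤ j + 2)]
    norm_num
    rw [reducedCount_reflect n 0 (j + 1) (by norm_num) (by omega), reducedCount_comm n 0 (-2 - _)]
    have h2 : reducedCount n 0 (j - 1) = reducedCount n (-2) (j - 1) + reducedCount n (-1 - j) 0 := by
      rw [reducedCount_reflect n 0 (j - 1) (by norm_num) (by omega), reducedCount_comm n 0 (-2 - _)]
      ring_nf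
    rw [h2]
    ring_nf
  · rw [if_neg hi.ne']
    simp only [halfPlaneCount]
    rw [reducedCount_succ _ _ _ (Or.inr hj), abs_of_pos hi, abs_of_pos (by omega : 0 < i + 1),
      abs_of_nonneg (by omega : 0 ≤ i - 1)]
    ring_nf

theorem halfPlaneCount_zero (i j : ℤ) (hj : 0 ≤ j) :
    halfPlaneCount 0 i j = if (i = 1 ∨ i = -1) ∧ j = 0 then 1 / 3 else 0 := by
  rw [halfPlaneCount, reducedCount_zero _ _ (by have := abs_nonneg i; omega) hj]
  refine if_congr ?_ rfl rfl
  rcases abs_cases i with h1 | h1 <;> omega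

end ReducedCounts

section KernelEquation

open LaurentPolynomial

/-- The generating polynomial of the reduced counts on the negative horizontal axis; the
coefficient of `X ^ k` belongs to the endpoint `(-2 - k, 0)`. -/
noncomputable def axisPoly (n : ℕ) : Polynomial ℚ :=
  ∑ k ∈ Finset.range (n + 1), Polynomial.monomial k (halfPlaneCount n (k + 1) 0)

theorem coeff_axisPoly (n k : ℕ) : (axisPoly n).coeff k = halfPlaneCount n (k + 1) 0 := by
  simp only [axisPoly, Polynomial.finsetSum_coeff, Polynomial.coeff_monomial,
    Finset.sum_ite_eq', Finset.mem_range]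
  split_ifs with h
  · rfl
  · rw [halfPlaneCount_eq_zero]; omega

/-- The generating Laurent polynomial of the `j`-th row of `halfPlaneCount n`. -/
noncomputable def rowPoly (n : ℕ) (j : ℤ) : ℚ[T;T⁻¹] :=
  AddMonoidAlgebra.ofCoeff (Finsupp.onFinset (Finset.Icc (-n - 1 : ℤ) (n + 1))
    (fun i => halfPlaneCount n i j) fun i hi => by
      by_contra h
      rw [Finset.mem_Icc] at h
      exact hi (halfPlaneCount_eq_zero _ _ _ (by omega)))

theorem coeff_rowPoly (n : ℕ) (i j : ℤ) : (rowPoly n j).coeff i = halfPlaneCount n i j := rfl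

theorem LaurentPolynomial.coeff_T_mul {R : Type*} [Semiring R] (f : R[T;T⁻¹]) (m i : ℤ) :
    (T m * f).coeff i = f.coeff (i - m) := by
  have := AddMonoidAlgebra.coeff_single_mul_apply f (1 : R) m i
  rw [one_mul, neg_add_eq_sub] at this
  exact this

theorem LaurentPolynomial.coeff_toLaurent_nat {R : Type*} [Semiring R] (p : Polynomial R) (k : ℕ) :
    (Polynomial.toLaurent p).coeff k = p.coeff k := by
  rw [coeff_toLaurent]
  exact Finsupp.mapDomain_apply Nat.cast_injective _ _

theorem LaurentPolynomial.coeff_toLaurent_of_neg {R : Type*} [Semiring R] (p : Polynomial R) (i : ℤ)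
    (hi : i < 0) : (Polynomial.toLaurent p).coeff i = 0 := by
  rw [coeff_toLaurent]
  refine Finsupp.mapDomain_of_notMem_range _ _ ?_
  rintro ⟨k, rfl⟩
  change (k : ℤ) < 0 at hi
  omega

theorem rowPoly_neg_one (n : ℕ) : rowPoly n (-1) = 0 :=
  LaurentPolynomial.ext fun i => by simp [coeff_rowPoly, halfPlaneCount_neg_one]

theorem rowPoly_eq_zero (n : ℕ) (j : ℤ) (h : n < j) : rowPoly n j = 0 :=
  LaurentPolynomial.ext fun i => by
    simp [coeff_rowPoly, halfPlaneCount_eq_zero n i j (Or.inr (Or.inr h))]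

theorem rowPoly_succ (n : ℕ) (j : ℤ) (hj : 0 ≤ j) :
    rowPoly (n + 1) j = (T 1 + T (-1)) * (rowPoly n (j + 1) + rowPoly n (j - 1)) +
      C (halfPlaneCount n (j + 2) 0 + halfPlaneCount n j 0) := by
  refine LaurentPolynomial.ext fun i => ?_
  simp only [add_mul, mul_add, AddMonoidAlgebra.coeff_add, Finsupp.add_apply, coeff_T_mul,
    coeff_rowPoly, C_apply, halfPlaneCount_succ n i j hj, sub_neg_eq_add]
  ring_nf

theorem rowPoly_zero_zero : rowPoly 0 0 = C (1 / 3) * (T 1 + T (-1)) := by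
  refine LaurentPolynomial.ext fun i => ?_
  rw [coeff_rowPoly, halfPlaneCount_zero _ _ le_rfl, mul_add, ← single_eq_C_mul_T,
    ← single_eq_C_mul_T]
  simp only [AddMonoidAlgebra.coeff_add, Finsupp.add_apply, AddMonoidAlgebra.coeff_single,
    Finsupp.single_apply]
  split_ifs <;> first | (simp; done) | grind

/-- Substitution of `x⁻¹` for `x`. -/
noncomputable def toLaurentInv : Polynomial ℚ →+* ℚ[T;T⁻¹] :=
  (LaurentPolynomial.invert (R := ℚ) : ℚ[T;T⁻¹] →+* ℚ[T;T⁻¹]).comp Polynomial.toLaurent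

theorem coeff_toLaurentInv (p : Polynomial ℚ) (i : ℤ) :
    (toLaurentInv p).coeff i = (Polynomial.toLaurent p).coeff (-i) := by
  simp [toLaurentInv]

theorem toLaurentInv_X : toLaurentInv Polynomial.X = T (-1) := by
  simp [toLaurentInv]

theorem toLaurentInv_C (a : ℚ) : toLaurentInv (Polynomial.C a) = C a := by
  simp [toLaurentInv]

theorem rowPoly_axis (n : ℕ) :
    rowPoly n 0 = T 1 * Polynomial.toLaurent (axisPoly n) + T (-1) * toLaurentInv (axisPoly n) := by
  refine LaurentPolynomial.ext fun i => ?_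
  rw [AddMonoidAlgebra.coeff_add, Finsupp.add_apply, coeff_T_mul, coeff_T_mul, coeff_rowPoly,
    coeff_toLaurentInv]
  rcases lt_trichotomy i 0 with hi | rfl | hi
  · obtain ⟨k, rfl⟩ : ∃ k : ℕ, i = -(k + 1) := ⟨(-i - 1).toNat, by omega⟩
    rw [coeff_toLaurent_of_neg _ _ (by omega), show -(-((k : ℤ) + 1) - -1) = k by ring,
      coeff_toLaurent_nat, coeff_axisPoly, halfPlaneCount_neg, zero_add]
  · rw [coeff_toLaurent_of_neg _ _ (by omega), coeff_toLaurent_of_neg _ _ (by omega),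
      halfPlaneCount_even _ _ (by simp), zero_add]
  · obtain ⟨k, rfl⟩ : ∃ k : ℕ, i = k + 1 := ⟨(i - 1).toNat, by omega⟩
    rw [coeff_toLaurent_of_neg _ (-_) (by omega), show (k : ℤ) + 1 - 1 = k by ring,
      coeff_toLaurent_nat, coeff_axisPoly, add_zero]

/-- The generating polynomial of `halfPlaneCount n` in the upper half plane. -/
noncomputable def halfPlanePoly (n : ℕ) : Polynomial ℚ[T;T⁻¹] :=
  ∑ j ∈ Finset.range (n + 1), Polynomial.monomial j (rowPoly n j)

theorem coeff_halfPlanePoly (n k : ℕ) : (halfPlanePoly n).coeff k = rowPoly n k := by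
  simp only [halfPlanePoly, Polynomial.finsetSum_coeff, Polynomial.coeff_monomial,
    Finset.sum_ite_eq', Finset.mem_range]
  split_ifs with h
  · rfl
  · rw [rowPoly_eq_zero]; omega

theorem halfPlanePoly_zero : halfPlanePoly 0 = Polynomial.C (C (1 / 3) * (T 1 + T (-1))) := by
  simp [halfPlanePoly, rowPoly_zero_zero]

theorem X_mul_halfPlanePoly_succ (n : ℕ) :
    Polynomial.X * halfPlanePoly (n + 1) =
      Polynomial.C (T 1 + T (-1)) * (1 + Polynomial.X ^ 2) * halfPlanePoly n -
      Polynomial.C ((T 1 + T (-1)) * rowPoly n 0) +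
      (1 + Polynomial.X ^ 2) * (axisPoly n).map C - Polynomial.C (C ((axisPoly n).coeff 0)) := by
  ext1 k
  simp only [Polynomial.coeff_add, Polynomial.coeff_sub, add_mul, one_mul, mul_assoc,
    Polynomial.coeff_C_mul, Polynomial.coeff_map]
  rcases k with _ | _ | k
  · simp [Polynomial.mul_coeff_zero, coeff_halfPlanePoly]
  · simp only [zero_add, Polynomial.coeff_X_mul, Polynomial.coeff_X_pow_mul',
      Polynomial.coeff_C, coeff_halfPlanePoly, coeff_axisPoly, Polynomial.coeff_map]
    have := rowPoly_succ n 0 le_rfl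
    norm_num [rowPoly_neg_one, halfPlaneCount_even] at this ⊢
    rw [this]
    ring
  · simp only [Polynomial.coeff_X_mul, Polynomial.coeff_X_pow_mul',
      Polynomial.coeff_C, coeff_halfPlanePoly, coeff_axisPoly, Polynomial.coeff_map]
    have := rowPoly_succ n (k + 1) (by omega)
    have e : k + 1 + 1 - 2 = k := by omega
    simp [e]
    rw [this]
    have e1 : (k : ℤ) + 1 + 2 = k + 1 + 1 + 1 := by ring
    rw [e1, map_add, add_sub_cancel_right]
    ring

end KernelEquation

section KernelSeries

open PowerSeries

/-- Constants, as Laurent polynomials in `x`. -/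
noncomputable abbrev laurentC : ℚ →+* LaurentPolynomial ℚ := LaurentPolynomial.C

/-- The Laurent polynomial `x + x⁻¹`. -/
noncomputable def laurentStep : LaurentPolynomial ℚ :=
  LaurentPolynomial.T 1 + LaurentPolynomial.T (-1)

/-- Substitution of the series `y` for the indeterminate. -/
noncomputable def evalSeries (y : (LaurentPolynomial ℚ)⟦X⟧) :
    Polynomial ℚ →+* (LaurentPolynomial ℚ)⟦X⟧ :=
  Polynomial.eval₂RingHom ((C : LaurentPolynomial ℚ →+* _).comp laurentC) y

/-- The generating series, by length, of the polynomials `axisPoly`. -/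
noncomputable def axisSeries : (Polynomial ℚ)⟦X⟧ := PowerSeries.mk axisPoly

/-- The generating series of the reduced counts ending at `(-2, 0)`. -/
noncomputable def axisHead : ℚ⟦X⟧ := PowerSeries.mk fun n => (axisPoly n).coeff 0

theorem halfPlaneSeries_eq :
    C Polynomial.X * (PowerSeries.mk halfPlanePoly - C (halfPlanePoly 0)) =
      X * (C (Polynomial.C laurentStep * (1 + Polynomial.X ^ 2)) * PowerSeries.mk halfPlanePoly -
        map Polynomial.C (C laurentStep * PowerSeries.mk fun n => rowPoly n 0) +
        C (1 + Polynomial.X ^ 2) * map (Polynomial.mapRingHom laurentC) axisSeries -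
        map (Polynomial.C.comp laurentC) axisHead) := by
  ext1 n
  cases n with
  | zero => simp
  | succ n =>
    rw [coeff_succ_X_mul, coeff_C_mul, map_sub, coeff_mk, coeff_C, if_neg n.succ_ne_zero, sub_zero,
      X_mul_halfPlanePoly_succ]
    rw [map_sub (coeff n), map_add (coeff n), map_sub (coeff n), coeff_C_mul, coeff_map, coeff_C_mul, coeff_C_mul, coeff_map,
      coeff_map, axisSeries, axisHead, coeff_mk, coeff_mk, coeff_mk, coeff_mk,
      Polynomial.coe_mapRingHom, RingHom.comp_apply, laurentStep]

theorem exists_kernel_root : ∃ y : (LaurentPolynomial ℚ)⟦X⟧,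
    y = X * C laurentStep * (1 + y ^ 2) ∧ coeff 0 y = 0 := by
  obtain ⟨y, h1, h2⟩ := exists_root_of_simple_root
    (Polynomial.X - Polynomial.C (X * C laurentStep) * (1 + Polynomial.X ^ 2)) 0
    (by simp) (by simp)
  refine ⟨y, ?_, by simpa using X_dvd_iff.1 h2⟩
  simpa [sub_eq_zero] using h1

theorem kernel_equation {y : (LaurentPolynomial ℚ)⟦X⟧}
    (hy : y = X * C laurentStep * (1 + y ^ 2)) :
    X * ((1 + C (LaurentPolynomial.T 1) ^ 2) * map Polynomial.toLaurent axisSeries +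
      (1 + C (LaurentPolynomial.T (-1)) ^ 2) * map toLaurentInv axisSeries -
      (1 + y ^ 2) * seriesLift (evalSeries y) axisSeries + map laurentC axisHead) =
    C (laurentC (1 / 3)) * C laurentStep * y := by
  let φ : Polynomial (LaurentPolynomial ℚ) →+* (LaurentPolynomial ℚ)⟦X⟧ :=
    Polynomial.eval₂RingHom C y
  have hφC : φ.comp Polynomial.C = C.comp (RingHom.id _) :=
    RingHom.ext fun a => by simp [φ]
  have hφX : φ Polynomial.X = y := by simp [φ]
  have hφ : ∀ a, φ (Polynomial.C a) = C a := fun a => by simp [φ]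
  have hφm : φ.comp (Polynomial.mapRingHom laurentC) = evalSeries y := by
    refine Polynomial.ringHom_ext (fun a => ?_) ?_ <;> simp [φ, evalSeries]
  have hφh : φ.comp (Polynomial.C.comp laurentC) = C.comp laurentC := by
    rw [← RingHom.comp_assoc, hφC]; rfl
  have key := congrArg (seriesLift φ) halfPlaneSeries_eq
  simp only [map_mul, map_add, map_sub, map_one, map_pow, seriesLift_X, seriesLift_C, hφX, hφ,
    seriesLift_map, hφm, hφh, seriesLift_C_comp, halfPlanePoly_zero] at key
  rw [hφC, seriesLift_C_comp, map_id, id_eq, RingHom.comp_apply, RingHom.id_apply] at key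
  have hrow : C laurentStep * (PowerSeries.mk fun n => rowPoly n 0) =
      (1 + C (LaurentPolynomial.T 1) ^ 2) * map Polynomial.toLaurent axisSeries +
      (1 + C (LaurentPolynomial.T (-1)) ^ 2) * map toLaurentInv axisSeries := by
    have h1 : (PowerSeries.mk fun n => rowPoly n 0) =
        C (LaurentPolynomial.T 1) * map Polynomial.toLaurent axisSeries +
        C (LaurentPolynomial.T (-1)) * map toLaurentInv axisSeries := by
      ext1 n
      simp [axisSeries, rowPoly_axis]
    have h2 : (C (LaurentPolynomial.T 1) : (LaurentPolynomial ℚ)⟦X⟧) *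
        C (LaurentPolynomial.T (-1)) = 1 := by
      rw [← map_mul, ← LaurentPolynomial.T_add]; simp
    rw [h1, laurentStep, map_add]
    linear_combination (map Polynomial.toLaurent axisSeries + map toLaurentInv axisSeries) * h2
  simp only [laurentStep, map_add] at hrow key hy ⊢
  linear_combination key - X * hrow - seriesLift φ (PowerSeries.mk halfPlanePoly) * hy

theorem eq_zero_of_kernel_equation {y : (LaurentPolynomial ℚ)⟦X⟧} (hy : coeff 0 y = 0)
    {d : (Polynomial ℚ)⟦X⟧} (hd : map Polynomial.toLaurent d + map toLaurentInv d -
      seriesLift (evalSeries y) d = 0) : d = 0 := by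
  refine eq_zero_of_forall_X_pow_dvd fun n => ?_
  induction n with
  | zero => simp
  | succ n ih =>
    obtain ⟨e, rfl⟩ := ih
    simp only [map_mul, map_pow, map_X, seriesLift_X, ← mul_add, ← mul_sub] at hd
    have he := (mul_eq_zero.1 hd).resolve_left (pow_ne_zero _ X_ne_zero)
    have h0 := congrArg (coeff 0) he
    rw [map_sub, map_add, coeff_map, coeff_map, coeff_zero_seriesLift, map_zero] at h0
    rw [pow_succ]
    refine mul_dvd_mul_left _ (X_dvd_iff.2 ?_)
    rw [← coeff_zero_eq_constantCoeff_apply]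
    generalize coeff 0 e = p at h0 ⊢
    have h1 : coeff 0 (evalSeries y p) = laurentC (p.coeff 0) := by
      have : (constantCoeff (R := LaurentPolynomial ℚ)).comp (evalSeries y) =
          laurentC.comp (Polynomial.constantCoeff) := by
        refine Polynomial.ringHom_ext (fun a => ?_) ?_
        · simp [evalSeries]
        · simpa [evalSeries] using hy
      simpa using congrArg (fun f => f p) this
    rw [h1] at h0
    ext k
    have h2 := congrArg (fun f => AddMonoidAlgebra.coeff f (k : ℤ)) h0
    simp only [AddMonoidAlgebra.coeff_sub, AddMonoidAlgebra.coeff_add, Finsupp.sub_apply,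
      Finsupp.add_apply, LaurentPolynomial.coeff_toLaurent_nat, coeff_toLaurentInv,
      LaurentPolynomial.C_apply, AddMonoidAlgebra.coeff_zero, Finsupp.zero_apply] at h2
    rcases k with _ | k
    · have := LaurentPolynomial.coeff_toLaurent_nat p 0
      norm_num at h2 this
      rw [this] at h2
      simpa using h2
    · rw [LaurentPolynomial.coeff_toLaurent_of_neg _ _ (by push_cast; omega),
        if_neg (by push_cast; omega)] at h2
      simpa using h2

end KernelSeries

section AlgebraicSolution

theorem cubic_of_parametrization {K : Type*} [Field K] [CharZero K] {Z w : K} (hZ : Z ≠ 0)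
    (hw : w ≠ 0) (hT : Z ^ 2 + (Z ^ 2 - 1) * w ≠ 0) {σ h z : K}
    (hσ : σ = -(1 + (Z ^ 2 + 3) * w) / (16 * w ^ 2 * (Z ^ 2 + (Z ^ 2 - 1) * w)))
    (hh : h = 1 / (4 * Z * w) - (Z ^ 2 + 3) * (Z ^ 2 - 1) * w / (4 * Z ^ 3))
    (hz : z = (Z ^ 2 - 1) * (Z ^ 2 + 3) ^ 3 / (256 * Z ^ 6)) :
    σ * h ^ 3 - ((Z ^ 2 + 3) * (Z ^ 4 + 3) / (16 * Z ^ 4) * σ - σ ^ 2 - z) * h -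
      (Z ^ 2 + 1) ^ 2 / (4 * Z ^ 3) * (σ ^ 2 - z) = 0 := by
  obtain ⟨P, hP⟩ : ∃ P, P = Z ^ 2 + (Z ^ 2 - 1) * w := ⟨_, rfl⟩
  rw [← hP] at hT hσ
  rw [hσ, hh, hz]
  field_simp
  rw [hP]
  ring

theorem cubic_of_resolvent {K : Type*} [Field K] [CharZero K] {X Z ρ z D N : K} (hZ : Z ≠ 0)
    (hρ : ρ ≠ 0) (hX : 1 + X ≠ 0) (hD : D = 1 - X + ρ * (1 + X)) (hD0 : D ≠ 0)
    (hE : 2 * D * Z ^ 2 - (Z ^ 2 - 1) * (1 + X) * ρ ≠ 0)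
    (hf : (Z ^ 2 + 1) * (1 + X) * ρ ^ 3 + 2 * Z ^ 2 * (1 - X) * ρ ^ 2 -
      (3 - Z ^ 2) * (1 + X) * ρ - 2 * (1 - X) = 0)
    (hz : (Z ^ 2 - 1) * (Z ^ 2 + 3) ^ 3 = 256 * z * Z ^ 6)
    (hN : N = -D / (2 * Z * ρ) + (Z ^ 2 + 3) * (Z ^ 2 - 1) * (1 + X) ^ 2 * ρ / (8 * Z ^ 3 * D)) :
    X * N ^ 3 - ((Z ^ 2 + 3) * (Z ^ 4 + 3) / (16 * Z ^ 4) * X * (1 + X) ^ 2 - X ^ 2 -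
      z * (1 + X) ^ 4) * N -
      (Z ^ 2 + 1) ^ 2 / (4 * Z ^ 3) * (X ^ 2 - z * (1 + X) ^ 4) * (1 + X) = 0 := by
  obtain ⟨w, hw⟩ : ∃ w, w = -(1 + X) * ρ / (2 * D) := ⟨_, rfl⟩
  have hw0 : w ≠ 0 := by
    rw [hw]
    exact div_ne_zero (mul_ne_zero (neg_ne_zero.2 hX) hρ) (mul_ne_zero two_ne_zero hD0)
  have hwD : 2 * w * D = -(1 + X) * ρ := by rw [hw]; field_simp
  have hT : Z ^ 2 + (Z ^ 2 - 1) * w ≠ 0 := by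
    intro h
    apply hE
    linear_combination 2 * D * h - (Z ^ 2 - 1) * hwD
  have hq : 2 * w * (1 - X) = -(2 * w + 1) * ρ * (1 + X) := by
    rw [hD] at hwD
    linear_combination hwD
  have hρ2 : ρ ^ 2 * (Z ^ 2 + (Z ^ 2 - 1) * w) = 1 + (Z ^ 2 - 1) * w := by
    have : ρ * (1 + X) * (ρ ^ 2 * (Z ^ 2 + (Z ^ 2 - 1) * w) - (1 + (Z ^ 2 - 1) * w)) = 0 := by
      linear_combination (-w) * hf + (Z ^ 2 * ρ ^ 2 - 1) * hq
    have := (mul_eq_zero.1 this).resolve_left (mul_ne_zero hρ hX)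
    linear_combination this
  have hσ : X / (1 + X) ^ 2 =
      -(1 + (Z ^ 2 + 3) * w) / (16 * w ^ 2 * (Z ^ 2 + (Z ^ 2 - 1) * w)) := by
    rw [div_eq_div_iff (pow_ne_zero _ hX)
      (mul_ne_zero (mul_ne_zero (by norm_num) (pow_ne_zero _ hw0)) hT)]
    linear_combination -(Z ^ 2 + (Z ^ 2 - 1) * w) *
      (2 * w * (1 - X) - (2 * w + 1) * ρ * (1 + X)) * hq -
      (2 * w + 1) ^ 2 * (1 + X) ^ 2 * hρ2
  have hh : N / (1 + X) =
      1 / (4 * Z * w) - (Z ^ 2 + 3) * (Z ^ 2 - 1) * w / (4 * Z ^ 3) := by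
    rw [hN, hw]
    field_simp
    ring
  have hz' : z = (Z ^ 2 - 1) * (Z ^ 2 + 3) ^ 3 / (256 * Z ^ 6) := by
    rw [hz]; field_simp
  have key := cubic_of_parametrization hZ hw0 hT hσ hh hz'
  have h5 : X * N ^ 3 - ((Z ^ 2 + 3) * (Z ^ 4 + 3) / (16 * Z ^ 4) * X * (1 + X) ^ 2 - X ^ 2 -
      z * (1 + X) ^ 4) * N -
      (Z ^ 2 + 1) ^ 2 / (4 * Z ^ 3) * (X ^ 2 - z * (1 + X) ^ 4) * (1 + X) =
      (1 + X) ^ 5 * (X / (1 + X) ^ 2 * (N / (1 + X)) ^ 3 -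
      ((Z ^ 2 + 3) * (Z ^ 4 + 3) / (16 * Z ^ 4) * (X / (1 + X) ^ 2) - (X / (1 + X) ^ 2) ^ 2 - z) *
      (N / (1 + X)) - (Z ^ 2 + 1) ^ 2 / (4 * Z ^ 3) * ((X / (1 + X) ^ 2) ^ 2 - z)) := by
    field_simp
  rw [h5, key, mul_zero]

end AlgebraicSolution

section AlgebraicSeries

open PowerSeries

theorem exists_parametrizing_series : ∃ Z : ℚ⟦X⟧,
    (Z ^ 2 - 1) * (Z ^ 2 + 3) ^ 3 = 256 * X ^ 2 * Z ^ 6 ∧ coeff 0 Z = 1 := by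
  obtain ⟨Z, h1, h2⟩ := exists_root_of_simple_root
    ((Polynomial.X ^ 2 - 1) * (Polynomial.X ^ 2 + 3) ^ 3 -
      Polynomial.C (256 * X ^ 2) * Polynomial.X ^ 6 : Polynomial ℚ⟦X⟧) 1
    ⟨-256 * X, by simp; ring⟩
    (by
      rw [PowerSeries.isUnit_iff_constantCoeff]
      simp [Polynomial.derivative_pow, map_ofNat]
      norm_num)
  refine ⟨Z, ?_, ?_⟩
  · simpa [sub_eq_zero] using h1
  · have := X_dvd_iff.1 h2
    simpa [sub_eq_zero] using this

theorem exists_axis_resolvent {R : Type*} [CommRing R] [Algebra ℚ R] (ξ : R) {Z : R⟦X⟧}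
    (hZ : coeff 0 Z = 1) : ∃ ρ : R⟦X⟧, coeff 0 ρ = 1 ∧
    (Z ^ 2 + 1) * (1 + C ξ) * ρ ^ 3 + 2 * Z ^ 2 * (1 - C ξ) * ρ ^ 2 -
      (3 - Z ^ 2) * (1 + C ξ) * ρ - 2 * (1 - C ξ) = 0 := by
  have hZ' : constantCoeff Z = 1 := by simpa using hZ
  have h8 : IsUnit (8 : R) := by
    have := (isUnit_iff_ne_zero.2 (by norm_num : (8 : ℚ) ≠ 0)).map (algebraMap ℚ R)
    rwa [map_ofNat] at this
  obtain ⟨ρ, h1, h2⟩ := exists_root_of_simple_root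
    (Polynomial.C ((Z ^ 2 + 1) * (1 + C ξ)) * Polynomial.X ^ 3 +
      Polynomial.C (2 * Z ^ 2 * (1 - C ξ)) * Polynomial.X ^ 2 -
      Polynomial.C ((3 - Z ^ 2) * (1 + C ξ)) * Polynomial.X -
      Polynomial.C (2 * (1 - C ξ))) 1
    (by
      rw [X_dvd_iff]
      simp [hZ', map_ofNat]
      ring)
    (by
      rw [PowerSeries.isUnit_iff_constantCoeff]
      convert h8 using 1
      simp [hZ', map_ofNat, Polynomial.derivative_pow]
      ring)
  refine ⟨ρ, ?_, ?_⟩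
  · have := X_dvd_iff.1 h2
    simpa [sub_eq_zero] using this
  · simpa using h1

theorem exists_axis_cubic {R : Type*} [CommRing R] [IsDomain R] [Algebra ℚ R] (ξ : R)
    (hξ : 1 + ξ ≠ 0) {Z V : R⟦X⟧} (hZ0 : coeff 0 Z = 1) (hZV : Z * V = 1)
    (hZ : (Z ^ 2 - 1) * (Z ^ 2 + 3) ^ 3 = 256 * X ^ 2 * Z ^ 6) :
    ∃ G N : R⟦X⟧, coeff 0 G = 0 ∧ N = (1 + C ξ) * G - 1 ∧
      16 * C ξ * N ^ 3 - ((Z ^ 2 + 3) * (Z ^ 4 + 3) * V ^ 4 * C ξ * (1 + C ξ) ^ 2 - 16 * C ξ ^ 2 -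
        16 * X ^ 2 * (1 + C ξ) ^ 4) * N -
        4 * (Z ^ 2 + 1) ^ 2 * V ^ 3 * (C ξ ^ 2 - X ^ 2 * (1 + C ξ) ^ 4) * (1 + C ξ) = 0 := by
  have hchar : CharZero R := algebraRat.charZero R
  obtain ⟨ρ, hρ0, hf⟩ := exists_axis_resolvent ξ hZ0
  have hZ0' : constantCoeff Z = 1 := by simpa using hZ0
  have hρ0' : constantCoeff ρ = 1 := by simpa using hρ0
  have hV0' : constantCoeff V = 1 := by simpa [hZ0'] using congrArg constantCoeff hZV
  have hu : ∀ q : ℚ, q ≠ 0 → IsUnit (algebraMap ℚ R q) := fun q hq =>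
    (isUnit_iff_ne_zero.2 hq).map _
  have h2 : IsUnit (2 : R) := map_ofNat (algebraMap ℚ R) 2 ▸ hu 2 two_ne_zero
  have h4 : IsUnit (4 : R) := map_ofNat (algebraMap ℚ R) 4 ▸ hu 4 four_ne_zero
  have hunit : ∀ (g : R⟦X⟧) (a : R), IsUnit a → constantCoeff g = a → IsUnit g :=
    fun g a ha hg => PowerSeries.isUnit_iff_constantCoeff.2 (hg ▸ ha)
  obtain ⟨D, hD⟩ : ∃ D, D = 1 - C ξ + ρ * (1 + C ξ) := ⟨_, rfl⟩
  have hDu : IsUnit D := hunit D 2 h2 (by rw [hD]; simp [hρ0']; ring)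
  have hEu : IsUnit (2 * D * Z ^ 2 - (Z ^ 2 - 1) * (1 + C ξ) * ρ) :=
    hunit _ 4 h4 (by rw [hD]; simp [hρ0', hZ0', map_ofNat]; ring)
  have hMu : IsUnit (Z * ρ + 1) := hunit _ 2 h2 (by simp [hρ0', hZ0']; ring)
  have hρu : IsUnit ρ := hunit _ 1 isUnit_one hρ0'
  have h8u : IsUnit (8 : R⟦X⟧) := hunit 8 (algebraMap ℚ R 8) (hu 8 (by norm_num)) (by simp [map_ofNat])
  obtain ⟨Di, hDi⟩ := hDu.exists_right_inv
  obtain ⟨Mi, hMi⟩ := hMu.exists_right_inv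
  obtain ⟨ρi, hρi⟩ := hρu.exists_right_inv
  obtain ⟨e, he⟩ := h8u.exists_right_inv
  let G : R⟦X⟧ := -(4 * e) * V * ρi * (4 * e * Mi *
    ((Z ^ 2 + 1) * ρ ^ 3 - 2 * Z ^ 2 * ρ ^ 2 - (3 - Z ^ 2) * ρ + 2) - (1 - ρ)) +
    e * (Z ^ 2 + 3) * (Z ^ 2 - 1) * V ^ 3 * (1 + C ξ) * ρ * Di
  refine ⟨G, (1 + C ξ) * G - 1, ?_, rfl, ?_⟩
  · simp only [coeff_zero_eq_constantCoeff, G]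
    simp [hρ0', hZ0', hV0', map_ofNat]
    norm_num
  let ι := algebraMap R⟦X⟧ (FractionRing R⟦X⟧)
  have hι : Function.Injective ι := IsFractionRing.injective _ _
  have hK : CharZero (FractionRing R⟦X⟧) := by
    have := charZero_of_injective_ringHom (C_injective (R := R))
    exact charZero_of_injective_ringHom hι
  have hne : ∀ a : R⟦X⟧, IsUnit a → ι a ≠ 0 := fun a ha => (ha.map ι).ne_zero
  have hι1 : 1 + ι (C ξ) ≠ 0 := by
    rw [← map_one ι, ← map_add, ← map_one C, ← map_add]
    exact (map_ne_zero_iff ι hι).2 ((map_ne_zero_iff C C_injective).2 hξ)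
  have hZu : IsUnit Z := .of_mul_eq_one _ hZV
  have e1 := eq_inv_of_mul_eq_one_right (by simpa using congrArg ι hZV : ι Z * ι V = 1)
  have e2 := eq_inv_of_mul_eq_one_right (by simpa using congrArg ι hDi : ι D * ι Di = 1)
  have e3 := eq_inv_of_mul_eq_one_right
    (by simpa using congrArg ι hMi : (ι Z * ι ρ + 1) * ι Mi = 1)
  have e4 := eq_inv_of_mul_eq_one_right (by simpa using congrArg ι hρi : ι ρ * ι ρi = 1)
  have e5 := eq_inv_of_mul_eq_one_right (by simpa [map_ofNat] using congrArg ι he : 8 * ι e = 1)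
  have hM0 : ι Z * ι ρ + 1 ≠ 0 := by simpa using hne _ hMu
  have hZ0 := hne _ hZu
  have hρ0 := hne _ hρu
  have hD0 := hne _ hDu
  have hf' := congrArg ι hf
  have hD' := congrArg ι hD
  have hz' := congrArg ι hZ
  have hE' := hne _ hEu
  simp only [map_add, map_sub, map_mul, map_pow, map_one, map_ofNat, map_zero] at hf' hD' hz' hE'
  have hN : ι ((1 + C ξ) * G - 1) = -ι D / (2 * ι Z * ι ρ) +
      (ι Z ^ 2 + 3) * (ι Z ^ 2 - 1) * (1 + ι (C ξ)) ^ 2 * ι ρ / (8 * ι Z ^ 3 * ι D) := by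
    have hL : (1 + ι (C ξ)) * ((ι Z ^ 2 + 1) * ι ρ ^ 3 - 2 * ι Z ^ 2 * ι ρ ^ 2 -
        (3 - ι Z ^ 2) * ι ρ + 2) = 4 * (1 - ι Z * ι ρ) * (ι Z * ι ρ + 1) := by
      linear_combination hf'
    simp only [G, map_add, map_sub, map_mul, map_pow, map_one, map_ofNat, map_neg, e1, e2, e3, e4,
      e5]
    have hL' : (1 + ι (C ξ)) * ((ι Z * ι ρ + 1)⁻¹ * ((ι Z ^ 2 + 1) * ι ρ ^ 3 -
        2 * ι Z ^ 2 * ι ρ ^ 2 - (3 - ι Z ^ 2) * ι ρ + 2)) = 4 * (1 - ι Z * ι ρ) := by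
      rw [mul_left_comm, hL]; field_simp
    have hA : -ι D / (2 * ι Z * ι ρ) = -((ι Z)⁻¹ * (ι ρ)⁻¹ / 4 * (4 * (1 - ι Z * ι ρ))) +
        (1 + ι (C ξ)) * (1 - ι ρ) * (ι Z)⁻¹ * (ι ρ)⁻¹ / 2 - 1 := by
      rw [hD']
      field_simp
      ring
    have hB : (ι Z ^ 2 + 3) * (ι Z ^ 2 - 1) * (1 + ι (C ξ)) ^ 2 * ι ρ / (8 * ι Z ^ 3 * ι D) =
        (1 + ι (C ξ)) * (8⁻¹ * (ι Z ^ 2 + 3) * (ι Z ^ 2 - 1) * (ι Z)⁻¹ ^ 3 * (1 + ι (C ξ)) * ι ρ *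
          (ι D)⁻¹) := by
      field_simp
    rw [hA, hB, ← hL']
    ring
  have key := cubic_of_resolvent hZ0 hρ0 hι1 hD' hD0 hE' hf' (z := ι X ^ 2)
    (by linear_combination hz') hN
  apply hι
  rw [map_zero, ← mul_zero (16 : FractionRing R⟦X⟧), ← key]
  simp only [map_add, map_sub, map_mul, map_pow, map_one, map_ofNat, e1]
  field_simp
  ring

end AlgebraicSeries

section KernelSolution

open PowerSeries

theorem add_add_eq_zero_of_cubic {A : Type*} [CommRing A] [IsDomain A] [CharZero A]
    {a b c p q : A} (ha : 16 * a ^ 3 - p * a - q = 0) (hb : 16 * b ^ 3 - p * b - q = 0)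
    (hc : 16 * c ^ 3 - p * c - q = 0) (hab : a ≠ b) (hac : a ≠ c) (hbc : b ≠ c) :
    a + b + c = 0 := by
  have h1 : 16 * (a ^ 2 + a * b + b ^ 2) - p = 0 :=
    mul_left_cancel₀ (sub_ne_zero.2 hab) (by linear_combination ha - hb)
  have h2 : 16 * (a ^ 2 + a * c + c ^ 2) - p = 0 :=
    mul_left_cancel₀ (sub_ne_zero.2 hac) (by linear_combination ha - hc)
  have h3 : 16 * (b - c) ≠ 0 := mul_ne_zero (by norm_num) (sub_ne_zero.2 hbc)
  exact mul_left_cancel₀ h3 (by linear_combination h1 - h2)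

theorem kernel_equation_of_cubic {A : Type*} [CommRing A] [IsDomain A] [CharZero A]
    {x x' s t y u c e N₁ N₂ N₃ H₁ H₂ M : A} (hxx : x * x' = 1) (hs : s = x + x')
    (hy : y = t * s * u) (hu : u = 1 + y ^ 2) (hu0 : u ≠ 0) (ht0 : t ≠ 0)
    (hN₁ : N₁ = x * H₁) (hN₂ : N₂ = x' * H₂) (hN₃ : N₃ = u * M)
    (h₁ : 16 * x ^ 2 * N₁ ^ 3 - (c * x ^ 2 * (1 + x ^ 2) ^ 2 - 16 * (x ^ 2) ^ 2 -
      16 * t ^ 2 * (1 + x ^ 2) ^ 4) * N₁ -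
      4 * e * ((x ^ 2) ^ 2 - t ^ 2 * (1 + x ^ 2) ^ 4) * (1 + x ^ 2) = 0)
    (h₂ : 16 * x' ^ 2 * N₂ ^ 3 - (c * x' ^ 2 * (1 + x' ^ 2) ^ 2 - 16 * (x' ^ 2) ^ 2 -
      16 * t ^ 2 * (1 + x' ^ 2) ^ 4) * N₂ -
      4 * e * ((x' ^ 2) ^ 2 - t ^ 2 * (1 + x' ^ 2) ^ 4) * (1 + x' ^ 2) = 0)
    (h₃ : 16 * y ^ 2 * N₃ ^ 3 - (c * y ^ 2 * (1 + y ^ 2) ^ 2 - 16 * (y ^ 2) ^ 2 -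
      16 * t ^ 2 * (1 + y ^ 2) ^ 4) * N₃ -
      4 * e * ((y ^ 2) ^ 2 - t ^ 2 * (1 + y ^ 2) ^ 4) * (1 + y ^ 2) = 0)
    (h₁₂ : H₁ ≠ H₂) (h₁₃ : H₁ ≠ -s * M) (h₂₃ : H₂ ≠ -s * M) : H₁ + H₂ - s * M = 0 := by
  have hx0 : x ≠ 0 := left_ne_zero_of_mul_eq_one hxx
  have hx'0 : x' ≠ 0 := right_ne_zero_of_mul_eq_one hxx
  have hu₁ : 1 + x ^ 2 = x * s := by rw [hs]; linear_combination -hxx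
  have hu₂ : 1 + x' ^ 2 = x' * s := by rw [hs]; linear_combination -hxx
  rw [hu₁, hN₁] at h₁
  rw [hu₂, hN₂] at h₂
  rw [← hu, hN₃, hy] at h₃
  have key := add_add_eq_zero_of_cubic (a := H₁) (b := H₂) (c := -s * M)
    (p := c * s ^ 2 - 16 - 16 * t ^ 2 * s ^ 4) (q := 4 * e * (1 - t ^ 2 * s ^ 4) * s)
    (mul_left_cancel₀ (pow_ne_zero 5 hx0) (by linear_combination h₁))
    (mul_left_cancel₀ (pow_ne_zero 5 hx'0) (by linear_combination h₂))
    (mul_left_cancel₀ (mul_ne_zero (pow_ne_zero 2 ht0) (pow_ne_zero 5 hu0))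
      (by linear_combination (-s) * h₃)) h₁₂ h₁₃ h₂₃
  linear_combination key

theorem axisSeries_cubic {Z V : ℚ⟦X⟧} (hZ0 : coeff 0 Z = 1) (hZV : Z * V = 1)
    (hZ : (Z ^ 2 - 1) * (Z ^ 2 + 3) ^ 3 = 256 * X ^ 2 * Z ^ 6) :
    ∃ N : (Polynomial ℚ)⟦X⟧, N = (1 + C (Polynomial.X ^ 2)) * (3 * X ^ 2 *
        ((1 + C (Polynomial.X ^ 2)) * axisSeries + map Polynomial.C axisHead)) - 1 ∧
      16 * C (Polynomial.X ^ 2) * N ^ 3 - (map Polynomial.C ((Z ^ 2 + 3) * (Z ^ 4 + 3) * V ^ 4) *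
        C (Polynomial.X ^ 2) * (1 + C (Polynomial.X ^ 2)) ^ 2 - 16 * C (Polynomial.X ^ 2) ^ 2 -
        16 * X ^ 2 * (1 + C (Polynomial.X ^ 2)) ^ 4) * N -
        4 * map Polynomial.C ((Z ^ 2 + 1) ^ 2 * V ^ 3) * (C (Polynomial.X ^ 2) ^ 2 -
        X ^ 2 * (1 + C (Polynomial.X ^ 2)) ^ 4) * (1 + C (Polynomial.X ^ 2)) = 0 := by
  have hξ : (1 + Polynomial.X ^ 2 : Polynomial ℚ) ≠ 0 := by
    intro h
    simpa using congrArg (fun p => Polynomial.coeff p 0) h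
  obtain ⟨G, N, hG0, hN, hcub⟩ := exists_axis_cubic (R := Polynomial ℚ) (Polynomial.X ^ 2) hξ
    (Z := map Polynomial.C Z) (V := map Polynomial.C V) (by rw [coeff_map, hZ0, map_one])
    (by rw [← map_mul, hZV, map_one]) (by
      have := congrArg (map (Polynomial.C : ℚ →+* Polynomial ℚ)) hZ
      simpa [map_ofNat] using this)
  have hcub' : 16 * C (Polynomial.X ^ 2) * N ^ 3 -
      (map Polynomial.C ((Z ^ 2 + 3) * (Z ^ 4 + 3) * V ^ 4) *
        C (Polynomial.X ^ 2) * (1 + C (Polynomial.X ^ 2)) ^ 2 - 16 * C (Polynomial.X ^ 2) ^ 2 -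
        16 * X ^ 2 * (1 + C (Polynomial.X ^ 2)) ^ 4) * N -
        4 * map Polynomial.C ((Z ^ 2 + 1) ^ 2 * V ^ 3) * (C (Polynomial.X ^ 2) ^ 2 -
        X ^ 2 * (1 + C (Polynomial.X ^ 2)) ^ 4) * (1 + C (Polynomial.X ^ 2)) = 0 := by
    rw [← hcub]
    simp only [map_mul, map_add, map_pow, map_ofNat, map_one]
    ring
  refine ⟨N, ?_, hcub'⟩
  suffices h : 3 * X ^ 2 * ((1 + C (Polynomial.X ^ 2)) * axisSeries + map Polynomial.C axisHead)
      = G by rw [h, hN]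
  obtain ⟨y, hy, hy0⟩ := exists_kernel_root
  have hy0' : constantCoeff y = 0 := by simpa using hy0
  have hNc : coeff 0 N = -1 := by
    have hG0' : constantCoeff G = 0 := by simpa using hG0
    rw [hN, coeff_zero_eq_constantCoeff_apply]; simp [hG0']
  have hhom : ∀ ψ : (Polynomial ℚ)⟦X⟧ →+* (LaurentPolynomial ℚ)⟦X⟧, ψ X = X →
      (∀ f : ℚ⟦X⟧, ψ (map Polynomial.C f) = map laurentC f) → ∀ v, ψ (C Polynomial.X) = v →
      16 * v ^ 2 * ψ N ^ 3 - (map laurentC ((Z ^ 2 + 3) * (Z ^ 4 + 3) * V ^ 4) * v ^ 2 *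
        (1 + v ^ 2) ^ 2 - 16 * (v ^ 2) ^ 2 - 16 * X ^ 2 * (1 + v ^ 2) ^ 4) * ψ N -
        4 * map laurentC ((Z ^ 2 + 1) ^ 2 * V ^ 3) * ((v ^ 2) ^ 2 - X ^ 2 * (1 + v ^ 2) ^ 4) *
        (1 + v ^ 2) = 0 ∧ ψ N = (1 + v ^ 2) * ψ G - 1 := by
    rintro ψ hX hψ v rfl
    constructor
    · rw [← map_zero ψ, ← hcub']
      rw [map_pow C]
      generalize (Z ^ 2 + 3) * (Z ^ 4 + 3) * V ^ 4 = c
      generalize (Z ^ 2 + 1) ^ 2 * V ^ 3 = e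
      simp only [map_mul, map_add, map_sub, map_pow, map_ofNat, map_one, hX, hψ]
    · rw [hN]
      simp only [map_mul, map_add, map_sub, map_pow, map_one]
  have hX₁ : map Polynomial.toLaurent (X : (Polynomial ℚ)⟦X⟧) = X := map_X _
  have hX₂ : map toLaurentInv (X : (Polynomial ℚ)⟦X⟧) = X := map_X _
  have hX₃ : seriesLift (evalSeries y) (X : (Polynomial ℚ)⟦X⟧) = X := seriesLift_X _
  have hC₁ : ∀ f : ℚ⟦X⟧, map Polynomial.toLaurent (map Polynomial.C f) = map laurentC f :=
    fun f => by ext1 n; simp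
  have hC₂ : ∀ f : ℚ⟦X⟧, map toLaurentInv (map Polynomial.C f) = map laurentC f :=
    fun f => by ext1 n; simp [toLaurentInv_C]
  have hC₃ : ∀ f : ℚ⟦X⟧, seriesLift (evalSeries y) (map Polynomial.C f) = map laurentC f := by
    intro f
    rw [seriesLift_map, ← seriesLift_C_comp]
    congr 1
    refine congrArg _ (RingHom.ext fun a => ?_)
    simp [evalSeries]
  have hv₁ : map Polynomial.toLaurent (C (Polynomial.X : Polynomial ℚ)) =
      C (LaurentPolynomial.T 1) := by simp
  have hv₂ : map toLaurentInv (C (Polynomial.X : Polynomial ℚ)) =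
      C (LaurentPolynomial.T (-1)) := by simp [toLaurentInv_X]
  have hv₃ : seriesLift (evalSeries y) (C (Polynomial.X : Polynomial ℚ)) = y := by
    rw [seriesLift_C]; simp [evalSeries]
  have hp := hhom _ hX₁ hC₁ _ hv₁
  have hm := hhom _ hX₂ hC₂ _ hv₂
  have he := hhom _ hX₃ hC₃ _ hv₃
  have hxx : (C (LaurentPolynomial.T 1) : (LaurentPolynomial ℚ)⟦X⟧) *
      C (LaurentPolynomial.T (-1)) = 1 := by
    rw [← map_mul, ← LaurentPolynomial.T_add]; simp
  have hu : IsUnit (1 + y ^ 2) := by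
    rw [PowerSeries.isUnit_iff_constantCoeff]; simp [hy0']
  obtain ⟨i, hi⟩ := hu.exists_right_inv
  have hi0 : constantCoeff i = 1 := by simpa [hy0'] using congrArg constantCoeff hi
  have hs : C laurentStep = (C (LaurentPolynomial.T 1) : (LaurentPolynomial ℚ)⟦X⟧) +
      C (LaurentPolynomial.T (-1)) := by rw [laurentStep, map_add]
  have hc1 : constantCoeff (map Polynomial.toLaurent N) = -1 := by
    rw [← coeff_zero_eq_constantCoeff_apply, coeff_map, hNc]; simp
  have hc2 : constantCoeff (map toLaurentInv N) = -1 := by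
    rw [← coeff_zero_eq_constantCoeff_apply, coeff_map, hNc]; simp
  have hc3 : constantCoeff (seriesLift (evalSeries y) N) = -1 := by
    rw [← coeff_zero_eq_constantCoeff_apply, coeff_zero_seriesLift, hNc]; simp
  have hT : ∀ a b : LaurentPolynomial ℚ, (∃ k, a.coeff k ≠ b.coeff k) →
      ∀ f g : (LaurentPolynomial ℚ)⟦X⟧, constantCoeff f = a → constantCoeff g = b → f ≠ g := by
    rintro a b ⟨k, hk⟩ f g rfl rfl rfl
    exact hk rfl
  have hchar : CharZero (LaurentPolynomial ℚ)⟦X⟧ :=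
    charZero_of_injective_ringHom (f := (C : LaurentPolynomial ℚ →+* _).comp laurentC)
      (RingHom.injective _)
  have hsum := kernel_equation_of_cubic hxx hs hy rfl hu.ne_zero X_ne_zero
    (N₁ := map Polynomial.toLaurent N) (N₂ := map toLaurentInv N)
    (N₃ := seriesLift (evalSeries y) N)
    (H₁ := C (LaurentPolynomial.T (-1)) * map Polynomial.toLaurent N)
    (H₂ := C (LaurentPolynomial.T 1) * map toLaurentInv N)
    (M := i * seriesLift (evalSeries y) N)
    (by linear_combination (-map Polynomial.toLaurent N) * hxx)
    (by linear_combination (-map toLaurentInv N) * hxx)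
    (by linear_combination (-seriesLift (evalSeries y) N) * hi)
    hp.1 hm.1 he.1
    (hT (-LaurentPolynomial.T (-1)) (-LaurentPolynomial.T 1) ⟨1, by simp⟩ _ _
      (by simp [hc1]) (by simp [hc2]))
    (hT (-LaurentPolynomial.T (-1)) laurentStep ⟨1, by simp [laurentStep]⟩ _ _
      (by simp [hc1]) (by simp [hi0, hc3]))
    (hT (-LaurentPolynomial.T 1) laurentStep ⟨-1, by simp [laurentStep]⟩ _ _
      (by simp [hc2]) (by simp [hi0, hc3]))
  have hGk : map Polynomial.toLaurent G + map toLaurentInv G - seriesLift (evalSeries y) G =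
      X * C laurentStep * y := by
    rw [hp.2, hm.2, he.2] at hsum
    have hmain : C laurentStep * (map Polynomial.toLaurent G + map toLaurentInv G -
        seriesLift (evalSeries y) G - X * C laurentStep * y) = 0 := by
      rw [hs] at hsum hy ⊢
      generalize map Polynomial.toLaurent G = G₁ at *
      generalize map toLaurentInv G = G₂ at *
      generalize seriesLift (evalSeries y) G = G₃ at *
      generalize (C (LaurentPolynomial.T 1) : (LaurentPolynomial ℚ)⟦X⟧) = x at *
      generalize (C (LaurentPolynomial.T (-1)) : (LaurentPolynomial ℚ)⟦X⟧) = x' at *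
      linear_combination hsum - (x * G₁ + x' * G₂) * hxx +
        (x + x') * (G₃ - 1 + X * (x + x') * y) * hi + (x + x') * i * y * hy
    have hne : (C laurentStep : (LaurentPolynomial ℚ)⟦X⟧) ≠ 0 := by
      intro h
      have h' := congrArg (fun f => (constantCoeff f).coeff 1) h
      simp [laurentStep] at h'
    exact sub_eq_zero.1 ((mul_eq_zero.1 hmain).resolve_left hne)
  rw [← sub_eq_zero]
  refine eq_zero_of_kernel_equation hy0 ?_
  have hk := kernel_equation hy
  have hl : ∀ ψ : (Polynomial ℚ)⟦X⟧ →+* (LaurentPolynomial ℚ)⟦X⟧, ψ X = X →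
      (∀ f : ℚ⟦X⟧, ψ (map Polynomial.C f) = map laurentC f) → ∀ v, ψ (C Polynomial.X) = v →
      ψ (3 * X ^ 2 * ((1 + C (Polynomial.X ^ 2)) * axisSeries + map Polynomial.C axisHead) - G) =
        3 * X ^ 2 * ((1 + v ^ 2) * ψ axisSeries + map laurentC axisHead) - ψ G := by
    rintro ψ hX hψ v rfl
    rw [map_pow C]
    simp only [map_mul, map_add, map_sub, map_pow, map_ofNat, map_one, hX, hψ]
  have h3 : (3 : (LaurentPolynomial ℚ)⟦X⟧) * C (laurentC (1 / 3)) = 1 := by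
    rw [← map_ofNat ((C : LaurentPolynomial ℚ →+* _).comp laurentC) 3, RingHom.comp_apply,
      ← map_mul, ← map_mul]
    norm_num
  rw [hl _ hX₁ hC₁ _ hv₁, hl _ hX₂ hC₂ _ hv₂, hl _ hX₃ hC₃ _ hv₃]
  linear_combination 3 * X * hk - hGk + X * C laurentStep * y * h3

end KernelSolution

section EndpointSeries

open PowerSeries

theorem eq_zero_and_eq_zero_of_map_C_add {a b : ℚ⟦X⟧} {r : (Polynomial ℚ)⟦X⟧}
    (h : map Polynomial.C a + C (Polynomial.X ^ 2) * map Polynomial.C b +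
      C (Polynomial.X ^ 3) * r = 0) : a = 0 ∧ b = 0 := by
  have h' : ∀ n k, ((Polynomial.C (coeff n a) + Polynomial.X ^ 2 * Polynomial.C (coeff n b) +
      Polynomial.X ^ 3 * coeff n r : Polynomial ℚ)).coeff k = 0 := by
    intro n k
    have := congrArg (fun f => (coeff n f).coeff k) h
    simpa only [map_add, coeff_map, coeff_C_mul, map_zero, Polynomial.coeff_zero] using this
  constructor <;> ext n
  · simpa [Polynomial.coeff_X_pow_mul'] using h' n 0
  · simpa [Polynomial.coeff_X_pow_mul', Polynomial.coeff_C] using h' n 2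

/-- The generating function of `reducedCount n (-4) 0`. -/
noncomputable def endpointSeries : ℚ⟦X⟧ := mk fun n => reducedCount n (-4) 0

theorem exists_axisSeries_eq : ∃ R : (Polynomial ℚ)⟦X⟧,
    axisSeries = map Polynomial.C axisHead + C (Polynomial.X ^ 2) * map Polynomial.C endpointSeries +
      C (Polynomial.X ^ 3) * R := by
  refine ⟨mk fun n => (axisPoly n).divX.divX.divX, ?_⟩
  ext n k
  have h1 : halfPlaneCount n 2 0 = 0 := halfPlaneCount_even n 2 (by norm_num)
  simp only [axisSeries, axisHead, endpointSeries, coeff_mk, map_add, coeff_map, coeff_C_mul,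
    Polynomial.coeff_add, Polynomial.coeff_X_pow_mul', Polynomial.coeff_C, Polynomial.coeff_divX,
    coeff_axisPoly]
  rcases k with _ | _ | _ | k
  · simp
  · simp [h1]
  · simp [halfPlaneCount]
  · simp

theorem endpointSeries_eq {Z V : ℚ⟦X⟧} (hZ0 : coeff 0 Z = 1) (hZV : Z * V = 1)
    (hZ : (Z ^ 2 - 1) * (Z ^ 2 + 3) ^ 3 = 256 * X ^ 2 * Z ^ 6) :
    192 * X ^ 4 * endpointSeries + 96 * X ^ 2 = ((Z ^ 2 + 1) ^ 2 * V ^ 3) ^ 3 -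
      ((Z ^ 2 + 3) * (Z ^ 4 + 3) * V ^ 4) * ((Z ^ 2 + 1) ^ 2 * V ^ 3) +
      8 * X ^ 2 * ((Z ^ 2 + 1) ^ 2 * V ^ 3) := by
  obtain ⟨N, hN, hcub⟩ := axisSeries_cubic hZ0 hZV hZ
  obtain ⟨R, hR⟩ := exists_axisSeries_eq
  generalize (Z ^ 2 + 3) * (Z ^ 4 + 3) * V ^ 4 = c at *
  generalize (Z ^ 2 + 1) ^ 2 * V ^ 3 = e at *
  obtain ⟨n₀, hn₀⟩ : ∃ n₀ : ℚ⟦X⟧, n₀ = 6 * X ^ 2 * axisHead - 1 := ⟨_, rfl⟩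
  obtain ⟨n₁, hn₁⟩ : ∃ n₁ : ℚ⟦X⟧, n₁ = 3 * X ^ 2 * (3 * axisHead + endpointSeries) := ⟨_, rfl⟩
  obtain ⟨x, hx⟩ : ∃ x : (Polynomial ℚ)⟦X⟧, x = C Polynomial.X := ⟨_, rfl⟩
  obtain ⟨M, hM⟩ : ∃ M, M = 3 * X ^ 2 * (R + 2 * x * (map Polynomial.C endpointSeries + x * R) +
    x * axisSeries) := ⟨_, rfl⟩
  rw [map_pow C, map_pow C, ← hx] at hR
  rw [map_pow C, ← hx] at hN hcub
  have hm₀ : map (Polynomial.C : ℚ →+* _) n₀ = 6 * X ^ 2 * map Polynomial.C axisHead - 1 := by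
    rw [hn₀]; simp [map_ofNat]
  have hm₁ : map (Polynomial.C : ℚ →+* _) n₁ =
      3 * X ^ 2 * (3 * map Polynomial.C axisHead + map Polynomial.C endpointSeries) := by
    rw [hn₁]; simp [map_ofNat]
  have hN' : N = map Polynomial.C n₀ + x ^ 2 * (map Polynomial.C n₁ + x * M) := by
    rw [hN, hm₀, hm₁, hM]
    linear_combination (3 * X ^ 2 * (1 + 2 * x ^ 2)) * hR
  have key := eq_zero_and_eq_zero_of_map_C_add (a := 16 * X ^ 2 * n₀ + 4 * e * X ^ 2)
    (b := 16 * X ^ 2 * n₁ + 16 * n₀ ^ 3 - c * n₀ + 64 * X ^ 2 * n₀ + 20 * e * X ^ 2)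
    (r := 16 * X ^ 2 * M + x * ((map Polynomial.C n₁ + x * M) * (16 * (N ^ 2 +
      N * map Polynomial.C n₀ + map Polynomial.C n₀ ^ 2) - map Polynomial.C c + 64 * X ^ 2) -
      (map Polynomial.C c * (2 + x ^ 2) - 16 - 16 * X ^ 2 * (6 + 4 * x ^ 2 + x ^ 4)) * N -
      4 * map Polynomial.C e * (1 + x ^ 2) +
      4 * map Polynomial.C e * X ^ 2 * (10 + 10 * x ^ 2 + 5 * x ^ 4 + x ^ 6))) (by
    simp only [map_add, map_sub, map_mul, map_pow, map_ofNat, map_X, ← hx]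
    generalize (map Polynomial.C n₀ : (Polynomial ℚ)⟦X⟧) = a at *
    linear_combination hcub -
      (16 * X ^ 2 + x ^ 2 * (16 * (N ^ 2 + N * a + a ^ 2) - map Polynomial.C c + 64 * X ^ 2)) * hN')
  obtain ⟨h₀, h₁⟩ := key
  have h4 : (4 : ℚ⟦X⟧) ≠ 0 := by
    have : CharZero ℚ⟦X⟧ := charZero_of_injective_ringHom (C_injective (R := ℚ))
    norm_num
  have h₀' : 4 * n₀ + e = 0 := by
    refine (mul_eq_zero.1 (?_ : 4 * X ^ 2 * (4 * n₀ + e) = 0)).resolve_left ?_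
    · linear_combination h₀
    · exact mul_ne_zero h4 (pow_ne_zero 2 X_ne_zero)
  linear_combination 4 * h₁ - 64 * X ^ 2 * hn₁ + 96 * X ^ 2 * hn₀ - (16 * n₀ ^ 2 - 4 * n₀ * e + e ^ 2 - c + 88 * X ^ 2) * h₀'

end EndpointSeries

section EulerOperator

open PowerSeries

/-- The Euler operator `X * d/dX` on power series. -/
noncomputable def eulerOp : Derivation ℚ ℚ⟦X⟧ ℚ⟦X⟧ := (X : ℚ⟦X⟧) • PowerSeries.derivative ℚ

theorem eulerOp_apply (f : ℚ⟦X⟧) : eulerOp f = X * PowerSeries.derivative ℚ f := rfl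

theorem coeff_eulerOp (f : ℚ⟦X⟧) (n : ℕ) : coeff n (eulerOp f) = n * coeff n f := by
  rw [eulerOp_apply]
  cases n with
  | zero => simp
  | succ n => rw [coeff_succ_X_mul, coeff_derivative]; push_cast; ring

theorem eulerOp_parametrizing {Z : ℚ⟦X⟧} (hZ0 : coeff 0 Z = 1)
    (hZ : (Z ^ 2 - 1) * (Z ^ 2 + 3) ^ 3 = 256 * X ^ 2 * Z ^ 6) :
    eulerOp Z * (Z ^ 2 - 3) ^ 2 = Z * (Z ^ 2 - 1) * (Z ^ 2 + 3) := by
  have hX : eulerOp (X : ℚ⟦X⟧) = X := by rw [eulerOp_apply]; simp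
  have h := congrArg eulerOp hZ
  have h256 : eulerOp (256 : ℚ⟦X⟧) = 0 := by exact_mod_cast eulerOp.map_natCast 256
  have h3 : eulerOp (3 : ℚ⟦X⟧) = 0 := by exact_mod_cast eulerOp.map_natCast 3
  simp only [Derivation.leibniz, Derivation.leibniz_pow, map_sub, map_add, Derivation.map_one_eq_zero,
    smul_eq_mul, nsmul_eq_mul, h3, h256, hX] at h
  have hZc : constantCoeff Z = 1 := by simpa using hZ0
  have hne : 2 * (Z ^ 2 + 3) ^ 2 ≠ 0 := fun h0 => by
    have := congrArg constantCoeff h0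
    norm_num [hZc, map_ofNat] at this
  refine mul_left_cancel₀ hne ?_
  push_cast at h
  linear_combination Z * h - (2 * Z + 6 * eulerOp Z) * hZ

theorem eulerOp_mul_aeval {Z V : ℚ⟦X⟧} (hZ0 : coeff 0 Z = 1) (hZV : Z * V = 1)
    (hZ : (Z ^ 2 - 1) * (Z ^ 2 + 3) ^ 3 = 256 * X ^ 2 * Z ^ 6) (p q : Polynomial ℚ)
    (h : (2 * Polynomial.X * Polynomial.derivative p - 9 * p) * (Polynomial.X - 1) *
      (Polynomial.X + 3) = q * (Polynomial.X - 3) ^ 2) :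
    eulerOp (V ^ 9 * Polynomial.aeval (Z ^ 2) p) = V ^ 9 * Polynomial.aeval (Z ^ 2) q := by
  have hV : eulerOp V = - V ^ 2 * eulerOp Z := by
    rw [eulerOp.leibniz_of_mul_eq_one ((mul_comm V Z).trans hZV), smul_eq_mul]
  have hp : eulerOp (Polynomial.aeval (Z ^ 2) p) =
      2 * Z * eulerOp Z * Polynomial.aeval (Z ^ 2) (Polynomial.derivative p) := by
    rw [Derivation.comp_aeval_eq, Derivation.leibniz_pow]
    simp only [smul_eq_mul, nsmul_eq_mul]
    push_cast
    ring
  have h' := congrArg (Polynomial.aeval (Z ^ 2)) h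
  simp only [map_mul, map_add, map_sub, map_pow, map_ofNat, map_one, Polynomial.aeval_X] at h'
  have hu := eulerOp_parametrizing hZ0 hZ
  have hZc : constantCoeff Z = 1 := by simpa using hZ0
  have hne : (Z ^ 2 - 3) ^ 2 ≠ 0 := fun h0 => by
    have := congrArg constantCoeff h0
    norm_num [hZc, map_ofNat] at this
  refine mul_left_cancel₀ hne ?_
  rw [Derivation.leibniz, Derivation.leibniz_pow, hV, hp]
  simp only [smul_eq_mul, nsmul_eq_mul]
  push_cast
  generalize Polynomial.aeval (Z ^ 2) p = P at *
  generalize Polynomial.aeval (Z ^ 2) (Polynomial.derivative p) = P' at *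
  linear_combination V ^ 9 * h' + V ^ 9 * (2 * Z * P' - 9 * V * P) * hu -
    9 * V ^ 9 * P * (Z ^ 2 - 1) * (Z ^ 2 + 3) * hZV

end EulerOperator

section HypergeometricSeries

open PowerSeries

variable {Z V : ℚ⟦X⟧}

theorem poch_zero (a : ℚ) : poch a 0 = 1 := by simp [poch]

theorem poch_succ (a : ℚ) (n : ℕ) : poch a (n + 1) = poch a n * (a + n) :=
  ascPochhammer_succ_eval n a

theorem poch_ne_zero {a : ℚ} (ha : 0 < a) (n : ℕ) : poch a n ≠ 0 :=
  (ascPochhammer_pos n a ha).ne'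

theorem coeff_recurrence_of_eulerOp {F : ℚ⟦X⟧} {α β γ : ℤ}
    (h : 3 * eulerOp (eulerOp F) + (α : ℚ⟦X⟧) * eulerOp F =
      16 * X ^ 2 * (3 * eulerOp (eulerOp F) + (β : ℚ⟦X⟧) * eulerOp F + (γ : ℚ⟦X⟧) * F)) (k : ℕ) :
    (3 * ((k : ℚ) + 2) ^ 2 + α * (k + 2)) * coeff (k + 2) F =
      16 * (3 * (k : ℚ) ^ 2 + β * k + γ) * coeff k F := by
  have h3 : (3 : ℚ⟦X⟧) = C 3 := (map_ofNat (C : ℚ →+* ℚ⟦X⟧) 3).symm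
  have h16 : (16 : ℚ⟦X⟧) = C 16 := (map_ofNat (C : ℚ →+* ℚ⟦X⟧) 16).symm
  have hc : ∀ a : ℤ, (a : ℚ⟦X⟧) = C (a : ℚ) := fun a => (map_intCast (C : ℚ →+* ℚ⟦X⟧) a).symm
  have h' := congrArg (coeff (k + 2)) h
  simp only [h3, h16, hc, mul_assoc, coeff_C_mul, coeff_X_pow_mul, map_add, coeff_eulerOp] at h'
  push_cast at h'
  linear_combination h'

theorem eulerOp_equation_of_polynomial (hZV : Z * V = 1)
    (hZ : (Z ^ 2 - 1) * (Z ^ 2 + 3) ^ 3 = 256 * X ^ 2 * Z ^ 6) {F : ℚ⟦X⟧} {α β γ : ℤ}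
    {p q r : Polynomial ℚ} (hp : F = V ^ 9 * Polynomial.aeval (Z ^ 2) p)
    (hq : eulerOp F = V ^ 9 * Polynomial.aeval (Z ^ 2) q)
    (hr : eulerOp (eulerOp F) = V ^ 9 * Polynomial.aeval (Z ^ 2) r)
    (h : 16 * Polynomial.X ^ 3 * (3 * r + (α : Polynomial ℚ) * q) =
      (Polynomial.X - 1) * (Polynomial.X + 3) ^ 3 * (3 * r + (β : Polynomial ℚ) * q +
        (γ : Polynomial ℚ) * p)) :
    3 * eulerOp (eulerOp F) + (α : ℚ⟦X⟧) * eulerOp F =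
      16 * X ^ 2 * (3 * eulerOp (eulerOp F) + (β : ℚ⟦X⟧) * eulerOp F + (γ : ℚ⟦X⟧) * F) := by
  have h' := congrArg (Polynomial.aeval (Z ^ 2)) h
  simp only [map_mul, map_add, map_sub, map_pow, map_ofNat, map_one, map_intCast,
    Polynomial.aeval_X] at h'
  have hne : (16 : ℚ⟦X⟧) * Z ^ 6 ≠ 0 := by
    have : CharZero ℚ⟦X⟧ := charZero_of_injective_ringHom (C_injective (R := ℚ))
    exact mul_ne_zero (by norm_num) (pow_ne_zero 6 (left_ne_zero_of_mul_eq_one hZV))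
  refine mul_left_cancel₀ hne ?_
  rw [hr, hq]
  conv_rhs => rw [hp]
  generalize Polynomial.aeval (Z ^ 2) p = P at *
  generalize Polynomial.aeval (Z ^ 2) q = Q at *
  generalize Polynomial.aeval (Z ^ 2) r = R at *
  linear_combination V ^ 9 * h' + V ^ 9 * (3 * R + (β : ℚ⟦X⟧) * Q + (γ : ℚ⟦X⟧) * P) * hZ

/-- The numerator of `64 * ₂F₁(-3/2, -5/6; 1/3; 16 X²)` in terms of the parametrizing series. -/
noncomputable def numeratorA : Polynomial ℚ :=
  -81 - 405 * Polynomial.X ^ 2 + 216 * Polynomial.X ^ 3 + 261 * Polynomial.X ^ 4 +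
    72 * Polynomial.X ^ 5 + Polynomial.X ^ 6

noncomputable def numeratorA₁ : Polynomial ℚ :=
  -243 - 567 * Polynomial.X ^ 2 + 288 * Polynomial.X ^ 3 + 423 * Polynomial.X ^ 4 +
    96 * Polynomial.X ^ 5 + 3 * Polynomial.X ^ 6

noncomputable def numeratorA₂ : Polynomial ℚ :=
  -729 - 621 * Polynomial.X ^ 2 + 504 * Polynomial.X ^ 3 + 669 * Polynomial.X ^ 4 +
    168 * Polynomial.X ^ 5 + 9 * Polynomial.X ^ 6

/-- The numerator of `320 * ₂F₁(-3/2, -7/6; 2/3; 16 X²)` in terms of the parametrizing series. -/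
noncomputable def numeratorB : Polynomial ℚ :=
  405 - 1458 * Polynomial.X - 405 * Polynomial.X ^ 2 + 324 * Polynomial.X ^ 3 +
    1179 * Polynomial.X ^ 4 + 270 * Polynomial.X ^ 5 + 5 * Polynomial.X ^ 6

noncomputable def numeratorB₁ : Polynomial ℚ :=
  1215 - 3402 * Polynomial.X - 1215 * Polynomial.X ^ 2 + 1476 * Polynomial.X ^ 3 +
    1521 * Polynomial.X ^ 4 + 390 * Polynomial.X ^ 5 + 15 * Polynomial.X ^ 6

noncomputable def numeratorB₂ : Polynomial ℚ :=
  3645 - 7938 * Polynomial.X - 3645 * Polynomial.X ^ 2 + 3924 * Polynomial.X ^ 3 +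
    3219 * Polynomial.X ^ 4 + 750 * Polynomial.X ^ 5 + 45 * Polynomial.X ^ 6

theorem eulerOp_numeratorA (hZ0 : coeff 0 Z = 1) (hZV : Z * V = 1)
    (hZ : (Z ^ 2 - 1) * (Z ^ 2 + 3) ^ 3 = 256 * X ^ 2 * Z ^ 6) :
    eulerOp (V ^ 9 * Polynomial.aeval (Z ^ 2) numeratorA) =
      V ^ 9 * Polynomial.aeval (Z ^ 2) numeratorA₁ := by
  refine eulerOp_mul_aeval hZ0 hZV hZ _ _ ?_
  simp [numeratorA, numeratorA₁, map_ofNat]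
  ring

theorem eulerOp_numeratorA₁ (hZ0 : coeff 0 Z = 1) (hZV : Z * V = 1)
    (hZ : (Z ^ 2 - 1) * (Z ^ 2 + 3) ^ 3 = 256 * X ^ 2 * Z ^ 6) :
    eulerOp (V ^ 9 * Polynomial.aeval (Z ^ 2) numeratorA₁) =
      V ^ 9 * Polynomial.aeval (Z ^ 2) numeratorA₂ := by
  refine eulerOp_mul_aeval hZ0 hZV hZ _ _ ?_
  simp [numeratorA₁, numeratorA₂, map_ofNat]
  ring

theorem eulerOp_numeratorB (hZ0 : coeff 0 Z = 1) (hZV : Z * V = 1)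
    (hZ : (Z ^ 2 - 1) * (Z ^ 2 + 3) ^ 3 = 256 * X ^ 2 * Z ^ 6) :
    eulerOp (V ^ 9 * Polynomial.aeval (Z ^ 2) numeratorB) =
      V ^ 9 * Polynomial.aeval (Z ^ 2) numeratorB₁ := by
  refine eulerOp_mul_aeval hZ0 hZV hZ _ _ ?_
  simp [numeratorB, numeratorB₁, map_ofNat]
  ring

theorem eulerOp_numeratorB₁ (hZ0 : coeff 0 Z = 1) (hZV : Z * V = 1)
    (hZ : (Z ^ 2 - 1) * (Z ^ 2 + 3) ^ 3 = 256 * X ^ 2 * Z ^ 6) :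
    eulerOp (V ^ 9 * Polynomial.aeval (Z ^ 2) numeratorB₁) =
      V ^ 9 * Polynomial.aeval (Z ^ 2) numeratorB₂ := by
  refine eulerOp_mul_aeval hZ0 hZV hZ _ _ ?_
  simp [numeratorB₁, numeratorB₂, map_ofNat]
  ring

theorem coeff_numeratorA (hZ0 : coeff 0 Z = 1) (hZV : Z * V = 1)
    (hZ : (Z ^ 2 - 1) * (Z ^ 2 + 3) ^ 3 = 256 * X ^ 2 * Z ^ 6) (n : ℕ) :
    coeff (2 * n + 4) (V ^ 9 * Polynomial.aeval (Z ^ 2) numeratorA) =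
      -5120 * 16 ^ n * (poch (1 / 2) n * poch (7 / 6) n / (poch 2 (n + 1) * poch (4 / 3) (n + 1))) := by
  have hrec := coeff_recurrence_of_eulerOp (eulerOp_equation_of_polynomial hZV hZ (α := -4)
    (β := -14) (γ := 15) rfl (eulerOp_numeratorA hZ0 hZV hZ)
    (by rw [eulerOp_numeratorA hZ0 hZV hZ, eulerOp_numeratorA₁ hZ0 hZV hZ])
    (by push_cast; simp only [numeratorA, numeratorA₁, numeratorA₂]; ring))
  have hZc : constantCoeff Z = 1 := by simpa using hZ0
  have hVc : constantCoeff V = 1 := by simpa [hZc] using congrArg constantCoeff hZV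
  have h0 : coeff 0 (V ^ 9 * Polynomial.aeval (Z ^ 2) numeratorA) = 64 := by
    rw [coeff_zero_eq_constantCoeff_apply]
    norm_num [numeratorA, hZc, hVc, map_ofNat]
  generalize V ^ 9 * Polynomial.aeval (Z ^ 2) numeratorA = F at *
  induction n with
  | zero =>
    have h1 := hrec 0
    have h2 := hrec 2
    norm_num [h0] at h1 h2
    norm_num [poch_succ, poch_zero]
    linarith
  | succ n ih =>
    have h := hrec (2 * n + 4)
    rw [ih] at h
    have e1 : ((2 : ℚ) + (n + 1 : ℕ)) ≠ 0 := by positivity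
    have e2 : ((4 / 3 : ℚ) + (n + 1 : ℕ)) ≠ 0 := by positivity
    have := poch_ne_zero (a := 2) (by norm_num) (n + 1)
    have := poch_ne_zero (a := 4 / 3) (by norm_num) (n + 1)
    rw [poch_succ _ n, poch_succ _ n, poch_succ _ (n + 1), poch_succ _ (n + 1)]
    refine mul_left_cancel₀ (mul_ne_zero e1 e2) ?_
    push_cast at h ⊢
    field_simp
    field_simp at h
    linear_combination 3 * h

theorem coeff_numeratorB (hZ0 : coeff 0 Z = 1) (hZV : Z * V = 1)
    (hZ : (Z ^ 2 - 1) * (Z ^ 2 + 3) ^ 3 = 256 * X ^ 2 * Z ^ 6) (n : ℕ) :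
    coeff (2 * n + 4) (V ^ 9 * Polynomial.aeval (Z ^ 2) numeratorB) =
      17920 * 16 ^ n * (poch (1 / 2) n * poch (5 / 6) n / (poch 2 (n + 1) * poch (5 / 3) (n + 1))) := by
  have hrec := coeff_recurrence_of_eulerOp (eulerOp_equation_of_polynomial hZV hZ (α := -2)
    (β := -16) (γ := 21) rfl (eulerOp_numeratorB hZ0 hZV hZ)
    (by rw [eulerOp_numeratorB hZ0 hZV hZ, eulerOp_numeratorB₁ hZ0 hZV hZ])
    (by push_cast; simp only [numeratorB, numeratorB₁, numeratorB₂]; ring))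
  have hZc : constantCoeff Z = 1 := by simpa using hZ0
  have hVc : constantCoeff V = 1 := by simpa [hZc] using congrArg constantCoeff hZV
  have h0 : coeff 0 (V ^ 9 * Polynomial.aeval (Z ^ 2) numeratorB) = 320 := by
    rw [coeff_zero_eq_constantCoeff_apply]
    norm_num [numeratorB, hZc, hVc, map_ofNat]
  generalize V ^ 9 * Polynomial.aeval (Z ^ 2) numeratorB = F at *
  induction n with
  | zero =>
    have h1 := hrec 0
    have h2 := hrec 2
    norm_num [h0] at h1 h2
    norm_num [poch_succ, poch_zero]
    linarith
  | succ n ih =>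
    have h := hrec (2 * n + 4)
    rw [ih] at h
    have e1 : ((2 : ℚ) + (n + 1 : ℕ)) ≠ 0 := by positivity
    have e2 : ((5 / 3 : ℚ) + (n + 1 : ℕ)) ≠ 0 := by positivity
    have := poch_ne_zero (a := 2) (by norm_num) (n + 1)
    have := poch_ne_zero (a := 5 / 3) (by norm_num) (n + 1)
    rw [poch_succ _ n, poch_succ _ n, poch_succ _ (n + 1), poch_succ _ (n + 1)]
    refine mul_left_cancel₀ (mul_ne_zero e1 e2) ?_
    push_cast at h ⊢
    field_simp
    field_simp at h
    linear_combination 3 * h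

theorem endpointSeries_eq_numerators (hZ0 : coeff 0 Z = 1) (hZV : Z * V = 1)
    (hZ : (Z ^ 2 - 1) * (Z ^ 2 + 3) ^ 3 = 256 * X ^ 2 * Z ^ 6) :
    12960 * (192 * X ^ 4 * endpointSeries + 96 * X ^ 2) =
      -(42 * eulerOp (eulerOp (V ^ 9 * Polynomial.aeval (Z ^ 2) numeratorA)) -
        216 * eulerOp (V ^ 9 * Polynomial.aeval (Z ^ 2) numeratorA) +
        80 * (V ^ 9 * Polynomial.aeval (Z ^ 2) numeratorA)) -
      (3 * eulerOp (eulerOp (V ^ 9 * Polynomial.aeval (Z ^ 2) numeratorB)) -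
        18 * eulerOp (V ^ 9 * Polynomial.aeval (Z ^ 2) numeratorB) -
        16 * (V ^ 9 * Polynomial.aeval (Z ^ 2) numeratorB)) := by
  have h6 : 256 * X ^ 2 = (Z ^ 2 - 1) * (Z ^ 2 + 3) ^ 3 * V ^ 6 := by
    have : Z ^ 6 * V ^ 6 = 1 := by rw [← mul_pow, hZV, one_pow]
    rw [hZ]
    linear_combination (-256 * X ^ 2) * this
  have h4 : V ^ 7 = V ^ 9 * Z ^ 2 := by linear_combination (-V ^ 7 * (Z * V + 1)) * hZV
  rw [eulerOp_numeratorA hZ0 hZV hZ, eulerOp_numeratorA₁ hZ0 hZV hZ,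
    eulerOp_numeratorB hZ0 hZV hZ, eulerOp_numeratorB₁ hZ0 hZV hZ,
    endpointSeries_eq hZ0 hZV hZ]
  simp only [numeratorA, numeratorA₁, numeratorA₂, numeratorB, numeratorB₁, numeratorB₂, map_add,
    map_sub, map_mul, map_neg, map_pow, map_ofNat, Polynomial.aeval_X]
  linear_combination 405 * (Z ^ 2 + 1) ^ 2 * V ^ 3 * h6 -
    12960 * (Z ^ 2 + 3) * (Z ^ 4 + 3) * (Z ^ 2 + 1) ^ 2 * h4

theorem reducedCount_eq (n : ℕ) : reducedCount (2 * n) (-4) 0 = 16 ^ n / 3 ^ 5 *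
    (4 * (21 * n ^ 2 + 30 * n - 14) *
      (poch (1 / 2) n * poch (7 / 6) n / (poch 2 (n + 1) * poch (4 / 3) (n + 1))) -
    7 * (3 * n ^ 2 + 3 * n - 10) *
      (poch (1 / 2) n * poch (5 / 6) n / (poch 2 (n + 1) * poch (5 / 3) (n + 1)))) := by
  obtain ⟨Z, hZ, hZ0⟩ := exists_parametrizing_series
  have hu : IsUnit Z := by
    have hZc : constantCoeff Z = 1 := by simpa using hZ0
    rw [PowerSeries.isUnit_iff_constantCoeff, hZc]
    exact isUnit_one
  obtain ⟨V, hZV⟩ := hu.exists_right_inv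
  have h := congrArg (coeff (2 * n + 4)) (endpointSeries_eq_numerators hZ0 hZV hZ)
  have hc : ∀ a : ℕ, [a.AtLeastTwo] → (OfNat.ofNat a : ℚ⟦X⟧) = C (OfNat.ofNat a : ℚ) :=
    fun a _ => (map_ofNat (C : ℚ →+* ℚ⟦X⟧) a).symm
  have hX : coeff (2 * n + 4) (X ^ 2 : ℚ⟦X⟧) = 0 := by
    rw [coeff_X_pow, if_neg (by omega)]
  simp only [hc, mul_assoc, coeff_C_mul, coeff_X_pow_mul, map_add, map_sub, map_neg,
    coeff_eulerOp, coeff_numeratorA hZ0 hZV hZ, coeff_numeratorB hZ0 hZV hZ, hX] at h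
  rw [endpointSeries, coeff_mk] at h
  push_cast at h
  linear_combination h / 2488320

end HypergeometricSeries

section Endpoint

theorem ballot_even_eq_choose (n k : ℕ) :
    ballot (2 * n) (2 * k - 2 * n) = (2 * n).choose k - (2 * n).choose (k + 1) := by
  have h1 := lineCount_eq_choose (2 * n) k
  have h2 := lineCount_eq_choose (2 * n) (k + 1)
  push_cast at h1 h2
  rw [ballot, h1, ← h2]
  congr 2
  ring

theorem choose_two_mul_eq_poch (n : ℕ) : ((2 * n).choose n : ℚ) * n.factorial = 4 ^ n * poch (1 / 2) n := by
  induction n with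
  | zero => simp [poch_zero]
  | succ n ih =>
    have h := Nat.succ_mul_centralBinom_succ n
    simp only [Nat.centralBinom] at h
    have h' : ((n : ℚ) + 1) * ((2 * (n + 1)).choose (n + 1)) = 2 * (2 * n + 1) * (2 * n).choose n := by
      exact_mod_cast h
    rw [poch_succ, Nat.factorial_succ]
    push_cast
    linear_combination (n.factorial : ℚ) * h' + 2 * (2 * n + 1) * ih

theorem poch_two (n : ℕ) : poch 2 n = (n + 1).factorial := by
  induction n with
  | zero => simp [poch_zero]
  | succ n ih => rw [poch_succ, ih, Nat.factorial_succ (n + 1)]; push_cast; ring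

theorem ballot_mul_ballot (n : ℕ) : ballot (2 * n) (-4) * ballot (2 * n) 0 =
    -3 * 16 ^ n * n * poch (1 / 2) n ^ 2 / (poch 2 n * poch 2 (n + 1)) := by
  have h0 : ballot (2 * n) 0 = (2 * n).choose n - (2 * n).choose (n + 1) := by
    rw [← ballot_even_eq_choose]; simp
  have h4 : ballot (2 * n) (-4) = (2 * n).choose (n + 2) - (2 * n).choose (n + 1) := by
    rw [show (-4 : ℤ) = -2 - 2 by norm_num, ballot_reflect]
    have := ballot_even_eq_choose n (n + 1)
    push_cast at this
    rw [show (2 : ℤ) * (n + 1) - 2 * n = 2 by ring] at this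
    rw [this]
    ring
  have e1 : ((2 * n).choose (n + 1) : ℚ) * (n + 1) = (2 * n).choose n * n := by
    have := Nat.choose_succ_right_eq (2 * n) n
    rw [show 2 * n - n = n by omega] at this
    exact_mod_cast this
  have e2 : ((2 * n).choose (n + 2) : ℚ) * (n + 2) = (2 * n).choose (n + 1) * (n - 1) := by
    rcases n with _ | n
    · simp
    have := Nat.choose_succ_right_eq (2 * (n + 1)) (n + 1 + 1)
    rw [show 2 * (n + 1) - (n + 1 + 1) = n by omega] at this
    have h : (((2 * (n + 1)).choose (n + 1 + 2) : ℕ) : ℚ) * (n + 1 + 2) =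
      (2 * (n + 1)).choose (n + 1 + 1) * n := by exact_mod_cast this
    push_cast
    linear_combination h
  have hc := choose_two_mul_eq_poch n
  have hf : (n.factorial : ℚ) ≠ 0 := by positivity
  have hn1 : (n : ℚ) + 1 ≠ 0 := by positivity
  have hn2 : (n : ℚ) + 2 ≠ 0 := by positivity
  have e1' : ((2 * n).choose (n + 1) : ℚ) = (2 * n).choose n * n / (n + 1) := by
    rw [eq_div_iff hn1, e1]
  have e2' : ((2 * n).choose (n + 2) : ℚ) = (2 * n).choose n * n / (n + 1) * (n - 1) / (n + 2) := by
    rw [eq_div_iff hn2, e2, e1']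
  have hc' : poch (1 / 2) n = (2 * n).choose n * n.factorial / 4 ^ n := by
    rw [eq_div_iff (by positivity), hc]; ring
  rw [h0, h4, e2', e1', poch_two, poch_two, Nat.factorial_succ (n + 1), Nat.factorial_succ n, hc']
  have h16 : (16 : ℚ) ^ n = 4 ^ n * 4 ^ n := by rw [← mul_pow]; norm_num
  rw [h16]
  push_cast
  field_simp
  ring

end Endpoint

theorem diag_threeQuadrant_endMinusFour_count (n : ℕ) :
    (walkCount diagSteps coneC (0, 0) (-4, 0) (2*n) : ℚ) =
      16^n / 3^5 *
        (-3^5 * (n : ℚ) * (poch (1/2) n)^2 / (poch 2 n * poch 2 (n+1))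
          + 4 * (21 * (n : ℚ)^2 + 30 * n - 14) *
              (poch (1/2) n * poch (7/6) n) / (poch 2 (n+1) * poch (4/3) (n+1))
          - 7 * (3 * (n : ℚ)^2 + 3 * n - 10) *
              (poch (1/2) n * poch (5/6) n) / (poch 2 (n+1) * poch (5/3) (n+1))) := by
  have h : (walkCount diagSteps coneC (0, 0) (-4, 0) (2 * n) : ℚ) =
      reducedCount (2 * n) (-4) 0 + ballot (2 * n) (-4) * ballot (2 * n) 0 / 3 := by
    rw [reducedCount, coneCount]; ring
  rw [h, reducedCount_eq, ballot_mul_ballot]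
  ring
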